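/- arXiv:2407.11430 — 2 statements merged into one kernel-verified Lean document; each statement's English description precedes it below -/
import Mathlib

section
/- Let A be a finite abelian group and n ≥ 2 an integer. Let K_n(A) be the kernel of the natural surjection M_n(A) → M_n⁻(A). Then the ℚ-linear map ψ : ⨁_B (M₁⁺(A/B) ⊗ M_{n−1}⁻(B)) ⊗ ℚ → K_n(A) ⊗ ℚ, where B ranges over the nonzero subgroups of A such that A/B is cyclic (possibly trivial), defined on generators by ψ(⟨a⟩⁺ ⊗ ⟨b₁, …, b_{n−1}⟩⁻) = ½(⟨ã, b₁, …, b_{n−1}⟩ + ⟨−ã, b₁, …, b_{n−1}⟩) for any lift ã ∈ A of a ∈ A/B, is a well-defined isomorphism of ℚ-vector spaces (independent of the choice of lifts). -/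
open FreeAbelianGroup AddSubgroup

/-- The set of `n`-tuples of elements of `A` which generate `A`. -/
def GenTuple (n : ℕ) (A : Type) [AddCommGroup A] : Type :=
  {b : Fin n → A // AddSubgroup.closure (Set.range b) = ⊤}

namespace KPT

variable (n : ℕ) (A : Type) [AddCommGroup A]

/-- Reordering relation (O). -/
def relO : Set (FreeAbelianGroup (GenTuple n A)) :=
  {x | ∃ (β β' : GenTuple n A) (σ : Equiv.Perm (Fin n)),
    β'.1 = β.1 ∘ σ ∧ x = of β - of β'}

/-- Motivic blowup relation (M). -/
def relM : Set (FreeAbelianGroup (GenTuple n A)) :=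
  {x | ∃ (hn : 2 ≤ n) (β β₁ β₂ : GenTuple n A),
    β₁.1 = Function.update β.1 ⟨0, by omega⟩
      (β.1 ⟨0, by omega⟩ - β.1 ⟨1, by omega⟩) ∧
    β₂.1 = Function.update β.1 ⟨1, by omega⟩
      (β.1 ⟨1, by omega⟩ - β.1 ⟨0, by omega⟩) ∧
    x = of β - of β₁ - of β₂}

/-- Anti-symmetry relation (A). -/
def relA : Set (FreeAbelianGroup (GenTuple n A)) :=
  {x | ∃ (hn : 1 ≤ n) (β β' : GenTuple n A),
    β'.1 = Function.update β.1 ⟨0, by omega⟩ (-(β.1 ⟨0, by omega⟩)) ∧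
    x = of β + of β'}

/-- The Kontsevich–Pestun–Tschinkel group `M_n(A)`. -/
def Mn : Type :=
  FreeAbelianGroup (GenTuple n A) ⧸ AddSubgroup.closure (relO n A ∪ relM n A)

instance : AddCommGroup (Mn n A) := QuotientAddGroup.Quotient.addCommGroup _

/-- The group `M_n^-(A)`. -/
def MnMinus : Type :=
  FreeAbelianGroup (GenTuple n A) ⧸
    AddSubgroup.closure (relO n A ∪ relM n A ∪ relA n A)

instance : AddCommGroup (MnMinus n A) := QuotientAddGroup.Quotient.addCommGroup _

/-- The symbol `⟨b₁,…,b_n⟩ ∈ M_n(A)`. -/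
def symb (β : GenTuple n A) : Mn n A := QuotientAddGroup.mk (of β)

/-- The symbol `⟨b₁,…,b_n⟩⁻ ∈ M_n⁻(A)`. -/
def symbm (β : GenTuple n A) : MnMinus n A := QuotientAddGroup.mk (of β)

/-- The natural surjection `M_n(A) → M_n⁻(A)`. -/
def toMinus : Mn n A →+ MnMinus n A :=
  QuotientAddGroup.map _ _ (AddMonoidHom.id _)
    (by
      intro x hx
      simp only [AddSubgroup.mem_comap, AddMonoidHom.id_apply]
      exact AddSubgroup.closure_mono (Set.subset_union_left) hx)

/-- The kernel `K_n(A)` of `M_n(A) → M_n⁻(A)`. -/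
def Kn : AddSubgroup (Mn n A) := (toMinus n A).ker

end KPT


namespace KPT

variable (A : Type) [AddCommGroup A]

/-- The relation (P): `⟨a⟩ = ⟨-a⟩`. -/
def relP : Set (FreeAbelianGroup (GenTuple 1 A)) :=
  {x | ∃ (β β' : GenTuple 1 A), β'.1 0 = -(β.1 0) ∧ x = of β - of β'}

/-- The group `M₁⁺(A)`, the quotient of `M₁(A)` by the relation (P). -/
def M1Plus : Type :=
  FreeAbelianGroup (GenTuple 1 A) ⧸
    AddSubgroup.closure (relO 1 A ∪ relM 1 A ∪ relP A)

instance : AddCommGroup (M1Plus A) := QuotientAddGroup.Quotient.addCommGroup _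

/-- The symbol `⟨a⟩⁺ ∈ M₁⁺(A)`. -/
def symbP (β : GenTuple 1 A) : M1Plus A := QuotientAddGroup.mk (of β)

end KPT

namespace KPT

section PairFunctions

variable {A V : Type*} [AddCommGroup A] [AddCommGroup V] {G : A → A → V}

theorem pair_add_neg_sub_right (hs : ∀ x y, G x y = G y x)
    (hm : ∀ x y, G x y = G (x - y) y + G x (y - x)) (x y : A) :
    G (x - y) y + G (-(x - y)) y = G x y + G (-x) y := by
  have h₁ := hm x y
  have h₂ := hm (y - x) y
  rw [sub_sub_cancel_left, sub_sub_cancel] at h₂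
  rw [neg_sub, h₁, h₂, hs x (y - x)]
  abel

/-- The sum of a symmetric blowup-additive function over all sign changes vanishes: it is
invariant under elementary moves, while the sum over any invariant finite set is twice itself. -/
theorem pair_sum_signs_eq_zero [Finite A] [Module ℚ V] (hs : ∀ x y, G x y = G y x)
    (hm : ∀ x y, G x y = G (x - y) y + G x (y - x)) (x y : A) :
    G x y + G (-x) y + (G x (-y) + G (-x) (-y)) = 0 := by
  classical
  have := Fintype.ofFinite A
  set T : A → A → V := fun x y => G x y + G (-x) y + (G x (-y) + G (-x) (-y)) with hT
  have hT_sub (x y : A) : T (x - y) y = T x y := by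
    have h₁ := pair_add_neg_sub_right hs hm x y
    have h₂ := pair_add_neg_sub_right hs hm (x - y) (-y)
    rw [sub_neg_eq_add, sub_add_cancel] at h₂
    simp only [hT, h₁, h₂]
  have hT_symm (x y : A) : T x y = T y x := by
    simp only [hT, hs y, hs (-y)]
    abel
  have hT_sub' (x y : A) : T x (y - x) = T x y := by
    rw [hT_symm, hT_sub, hT_symm]
  have hT_neg (x y : A) : T (-x) y = T x y := by
    simp only [hT, neg_neg]
    abel
  have hT_neg' (x y : A) : T x (-y) = T x y := by
    rw [hT_symm, hT_neg, hT_symm]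
  set t := T x y with ht
  set H : A × A → V := fun p => if T p.1 p.2 = t then G p.1 p.2 else 0 with hH
  have sum_comp (f : A × A → A × A) (hf : f.Injective) : ∑ p, H (f p) = ∑ p, H p :=
    (Equiv.ofBijective f (Finite.injective_iff_bijective.1 hf)).sum_comp H
  have hH_split (p : A × A) : H p = H (p.1 - p.2, p.2) + H (p.1, p.2 - p.1) := by
    simp only [hH, hT_sub, hT_sub']
    split_ifs
    · exact hm _ _
    · simp
  have hsum : ∑ p, H p = 0 := by
    have h : ∑ p, H p = ∑ p, H p + ∑ p, H p := by
      conv_lhs => rw [Finset.sum_congr rfl fun p _ => hH_split p, Finset.sum_add_distrib,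
        sum_comp (fun p => (p.1 - p.2, p.2)) (fun p q h => by
          simp only [Prod.mk.injEq] at h
          refine Prod.ext ?_ h.2
          simpa [h.2] using h.1),
        sum_comp (fun p => (p.1, p.2 - p.1)) (fun p q h => by
          simp only [Prod.mk.injEq] at h
          refine Prod.ext h.1 ?_
          simpa [h.1] using h.2)]
    simpa using h
  have hsigns (p : A × A) : (if T p.1 p.2 = t then t else 0) =
      H p + H (-p.1, p.2) + (H (p.1, -p.2) + H (-p.1, -p.2)) := by
    simp only [hH, hT_neg, hT_neg']
    split_ifs with h
    · exact h.symm
    · simp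
  have htotal : ∑ p : A × A, (if T p.1 p.2 = t then t else 0) = 0 := by
    rw [Finset.sum_congr rfl fun p _ => hsigns p]
    simp only [Finset.sum_add_distrib]
    rw [sum_comp (fun p => (-p.1, p.2)) (fun p q h => by simpa [Prod.ext_iff] using h),
      sum_comp (fun p => (p.1, -p.2)) (fun p q h => by simpa [Prod.ext_iff] using h),
      sum_comp (fun p => (-p.1, -p.2)) (fun p q h => by simpa [Prod.ext_iff] using h), hsum]
    simp
  rw [← Finset.sum_filter, Finset.sum_const, ← Nat.cast_smul_eq_nsmul ℚ, smul_eq_zero,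
    Nat.cast_eq_zero, Finset.card_eq_zero] at htotal
  refine htotal.resolve_left (Finset.Nonempty.ne_empty ⟨(x, y), ?_⟩)
  simp [ht]

end PairFunctions

section Tuples

variable {n : ℕ}

theorem exists_perm_zero_one (hn : 2 ≤ n) {i j : Fin n} (hij : i ≠ j) :
    ∃ σ : Equiv.Perm (Fin n), σ ⟨0, by omega⟩ = i ∧ σ ⟨1, by omega⟩ = j := by
  set p : Fin n := ⟨0, by omega⟩
  set q : Fin n := ⟨1, by omega⟩
  have hpq : p ≠ q := by simp [p, q]
  have hp : p ≠ Equiv.swap p i j := fun h => hij <| by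
    have h' := congrArg (Equiv.swap p i) h
    rwa [Equiv.swap_apply_left, Equiv.swap_apply_self] at h'
  refine ⟨Equiv.swap p i * Equiv.swap q (Equiv.swap p i j), ?_, ?_⟩
  · rw [Equiv.Perm.mul_apply, Equiv.swap_apply_of_ne_of_ne hpq hp, Equiv.swap_apply_left]
  · rw [Equiv.Perm.mul_apply, Equiv.swap_apply_left, Equiv.swap_apply_self]

theorem update_comp_perm {A : Type*} (b : Fin n → A) (σ : Equiv.Perm (Fin n)) (i : Fin n) (x : A) :
    Function.update (b ∘ σ) i x = Function.update b (σ i) x ∘ σ :=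
  (Function.update_comp_eq_of_injective b σ.injective i x).symm

variable {A : Type*} [AddCommGroup A]

theorem closure_range_le_iff {b : Fin n → A} {B : AddSubgroup A} :
    AddSubgroup.closure (Set.range b) ≤ B ↔ ∀ i, b i ∈ B := by
  rw [AddSubgroup.closure_le, Set.range_subset_iff]
  rfl

theorem mem_closure_range (b : Fin n → A) (i : Fin n) : b i ∈ AddSubgroup.closure (Set.range b) :=
  AddSubgroup.subset_closure ⟨i, rfl⟩

theorem closure_range_comp_perm (b : Fin n → A) (σ : Equiv.Perm (Fin n)) :
    AddSubgroup.closure (Set.range (b ∘ σ)) = AddSubgroup.closure (Set.range b) := by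
  rw [EquivLike.range_comp]

theorem closure_range_update_sub (b : Fin n → A) {i j : Fin n} (hij : i ≠ j) :
    AddSubgroup.closure (Set.range (Function.update b i (b i - b j))) =
      AddSubgroup.closure (Set.range b) := by
  apply le_antisymm
  · refine closure_range_le_iff.2 fun k => ?_
    rcases eq_or_ne k i with rfl | hk
    · rw [Function.update_self]
      exact sub_mem (mem_closure_range b _) (mem_closure_range b _)
    · rw [Function.update_of_ne hk]
      exact mem_closure_range b k
  · refine closure_range_le_iff.2 fun k => ?_
    have h := mem_closure_range (Function.update b i (b i - b j))
    rcases eq_or_ne k i with rfl | hk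
    · simpa [Function.update_of_ne hij.symm] using add_mem (h k) (h j)
    · simpa [Function.update_of_ne hk] using h k

theorem closure_range_update_neg (b : Fin n → A) (i : Fin n) :
    AddSubgroup.closure (Set.range (Function.update b i (-b i))) =
      AddSubgroup.closure (Set.range b) := by
  apply le_antisymm
  · refine closure_range_le_iff.2 fun k => ?_
    rcases eq_or_ne k i with rfl | hk
    · simpa using mem_closure_range b k
    · simpa [Function.update_of_ne hk] using mem_closure_range b k
  · refine closure_range_le_iff.2 fun k => ?_
    have h := mem_closure_range (Function.update b i (-b i)) k
    rcases eq_or_ne k i with rfl | hk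
    · simpa using h
    · simpa [Function.update_of_ne hk] using h

theorem closure_range_cons (a : A) (b : Fin n → A) :
    AddSubgroup.closure (Set.range (Fin.cons a b : Fin (n + 1) → A)) =
      AddSubgroup.closure {a} ⊔ AddSubgroup.closure (Set.range b) := by
  rw [Fin.range_cons, Set.insert_eq, AddSubgroup.closure_union]

theorem closure_range_cons_neg (a : A) (b : Fin n → A) :
    AddSubgroup.closure (Set.range (Fin.cons (-a) b : Fin (n + 1) → A)) =
      AddSubgroup.closure {a} ⊔ AddSubgroup.closure (Set.range b) := by
  rw [closure_range_cons, ← Set.neg_singleton, AddSubgroup.closure_neg]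

theorem closure_range_coe_eq_iff {B : AddSubgroup A} (b : Fin n → B) :
    AddSubgroup.closure (Set.range fun i => (b i : A)) = B ↔
      AddSubgroup.closure (Set.range b) = ⊤ := by
  have h : AddSubgroup.closure (Set.range fun i => (b i : A)) =
      (AddSubgroup.closure (Set.range b)).map B.subtype := by
    rw [AddMonoidHom.map_closure, ← Set.range_comp]
    rfl
  rw [h]
  conv_lhs => rhs; rw [← AddSubgroup.range_subtype B, AddMonoidHom.range_eq_map]
  exact (AddSubgroup.map_injective B.subtype_injective).eq_iff

theorem closure_singleton_mk_eq_top_iff (a : A) (B : AddSubgroup A) :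
    AddSubgroup.closure {(QuotientAddGroup.mk a : A ⧸ B)} = ⊤ ↔
      AddSubgroup.closure {a} ⊔ B = ⊤ := by
  have h : AddSubgroup.closure {(QuotientAddGroup.mk a : A ⧸ B)} =
      (AddSubgroup.closure {a}).map (QuotientAddGroup.mk' B) := by
    rw [AddMonoidHom.map_closure, Set.image_singleton]
    rfl
  rw [h, ← (AddSubgroup.comap_injective (QuotientAddGroup.mk'_surjective B)).eq_iff,
    AddSubgroup.comap_map_eq, QuotientAddGroup.ker_mk', AddSubgroup.comap_top]

/-- A function of tuples which is symmetric and satisfies the blowup relation in the first two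
entries satisfies it in any two entries. -/
theorem blowup_of_blowup_zero_one {V : Type*} [Add V] {F : (Fin n → A) → V}
    (hperm : ∀ b (σ : Equiv.Perm (Fin n)), F (b ∘ σ) = F b)
    (hblow : ∀ (hn : 2 ≤ n) (b : Fin n → A), F b =
      F (Function.update b ⟨0, by omega⟩ (b ⟨0, by omega⟩ - b ⟨1, by omega⟩)) +
      F (Function.update b ⟨1, by omega⟩ (b ⟨1, by omega⟩ - b ⟨0, by omega⟩)))
    (b : Fin n → A) {i j : Fin n} (hij : i ≠ j) :
    F b = F (Function.update b i (b i - b j)) + F (Function.update b j (b j - b i)) := by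
  have hn : 2 ≤ n := by
    have := Fin.val_ne_of_ne hij
    omega
  obtain ⟨σ, rfl, rfl⟩ := exists_perm_zero_one hn hij
  have h := hblow hn (b ∘ σ)
  simpa only [update_comp_perm, hperm, Function.comp_apply] using h

end Tuples

section Symbols

variable (n : ℕ) (A : Type) [AddCommGroup A]

open Classical in
/-- The symbol `⟨b₁,…,b_n⟩ ∈ M_n(A)`, extended by zero to tuples which do not generate `A`. -/
noncomputable def extSymb (b : Fin n → A) : Mn n A :=
  if h : AddSubgroup.closure (Set.range b) = ⊤ then symb n A ⟨b, h⟩ else 0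

variable {A} in
open Classical in
/-- The symbol `⟨b₁,…,b_n⟩⁻ ∈ M_n⁻(B)`, extended by zero to tuples in `A` which do not
generate `B`. -/
noncomputable def extSymbm (B : AddSubgroup A) (b : Fin n → A) : MnMinus n B :=
  if h : AddSubgroup.closure (Set.range b) = B then
    symbm n B ⟨fun i => ⟨b i, h.le (mem_closure_range b i)⟩, (closure_range_coe_eq_iff _).1 h⟩
  else 0

open Classical in
/-- The symbol `⟨a⟩⁺ ∈ M₁⁺(A)`, extended by zero to elements which do not generate `A`. -/
noncomputable def extSymbP (a : A) : M1Plus A :=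
  if h : AddSubgroup.closure {a} = ⊤ then symbP A ⟨fun _ => a, by rwa [Set.range_const]⟩ else 0

variable {n A}

theorem mk_eq_mk_of_sub_mem {G : Type*} [AddCommGroup G] {s : Set G} {x y : G} (h : x - y ∈ s) :
    (QuotientAddGroup.mk x : G ⧸ AddSubgroup.closure s) = QuotientAddGroup.mk y :=
  QuotientAddGroup.eq_iff_sub_mem.2 (AddSubgroup.subset_closure h)

theorem symb_eq_of_perm (β β' : GenTuple n A) (σ : Equiv.Perm (Fin n)) (h : β'.1 = β.1 ∘ σ) :
    symb n A β = symb n A β' :=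
  mk_eq_mk_of_sub_mem (x := of β) (y := of β') (Or.inl ⟨β, β', σ, h, rfl⟩)

theorem symb_blowup (hn : 2 ≤ n) (β β₁ β₂ : GenTuple n A)
    (h₁ : β₁.1 = Function.update β.1 ⟨0, by omega⟩ (β.1 ⟨0, by omega⟩ - β.1 ⟨1, by omega⟩))
    (h₂ : β₂.1 = Function.update β.1 ⟨1, by omega⟩ (β.1 ⟨1, by omega⟩ - β.1 ⟨0, by omega⟩)) :
    symb n A β = symb n A β₁ + symb n A β₂ :=
  mk_eq_mk_of_sub_mem (x := of β) (y := of β₁ + of β₂)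
    (Or.inr ⟨hn, β, β₁, β₂, h₁, h₂, (sub_sub _ _ _).symm⟩)

theorem symbm_eq_of_perm (β β' : GenTuple n A) (σ : Equiv.Perm (Fin n)) (h : β'.1 = β.1 ∘ σ) :
    symbm n A β = symbm n A β' :=
  mk_eq_mk_of_sub_mem (x := of β) (y := of β') (Or.inl (Or.inl ⟨β, β', σ, h, rfl⟩))

theorem symbm_blowup (hn : 2 ≤ n) (β β₁ β₂ : GenTuple n A)
    (h₁ : β₁.1 = Function.update β.1 ⟨0, by omega⟩ (β.1 ⟨0, by omega⟩ - β.1 ⟨1, by omega⟩))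
    (h₂ : β₂.1 = Function.update β.1 ⟨1, by omega⟩ (β.1 ⟨1, by omega⟩ - β.1 ⟨0, by omega⟩)) :
    symbm n A β = symbm n A β₁ + symbm n A β₂ :=
  mk_eq_mk_of_sub_mem (x := of β) (y := of β₁ + of β₂)
    (Or.inl (Or.inr ⟨hn, β, β₁, β₂, h₁, h₂, (sub_sub _ _ _).symm⟩))

theorem symbm_add_update_neg (hn : 1 ≤ n) (β β' : GenTuple n A)
    (h : β'.1 = Function.update β.1 ⟨0, by omega⟩ (-(β.1 ⟨0, by omega⟩))) :
    symbm n A β + symbm n A β' = 0 :=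
  mk_eq_mk_of_sub_mem (x := of β + of β') (y := 0) (Or.inr ⟨hn, β, β', h, sub_zero _⟩)

theorem symbP_eq_of_neg (β β' : GenTuple 1 A) (h : β'.1 0 = -β.1 0) :
    symbP A β = symbP A β' :=
  mk_eq_mk_of_sub_mem (x := of β) (y := of β') (Or.inr ⟨β, β', h, rfl⟩)

theorem extSymb_of_closure_eq_top {b : Fin n → A} (h : AddSubgroup.closure (Set.range b) = ⊤) :
    extSymb n A b = symb n A ⟨b, h⟩ :=
  dif_pos h

theorem extSymb_coe (β : GenTuple n A) : extSymb n A β.1 = symb n A β :=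
  dif_pos β.2

theorem extSymb_comp_perm (b : Fin n → A) (σ : Equiv.Perm (Fin n)) :
    extSymb n A (b ∘ σ) = extSymb n A b := by
  by_cases h : AddSubgroup.closure (Set.range b) = ⊤
  · have h' := (closure_range_comp_perm b σ).trans h
    rw [extSymb_of_closure_eq_top h, extSymb_of_closure_eq_top h']
    exact (symb_eq_of_perm _ _ σ rfl).symm
  · rw [extSymb, extSymb, dif_neg h, dif_neg (by rwa [closure_range_comp_perm])]

theorem extSymb_blowup (b : Fin n → A) {i j : Fin n} (hij : i ≠ j) :
    extSymb n A b = extSymb n A (Function.update b i (b i - b j)) +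
      extSymb n A (Function.update b j (b j - b i)) := by
  refine blowup_of_blowup_zero_one extSymb_comp_perm (fun hn b => ?_) b hij
  have h01 : (⟨0, by omega⟩ : Fin n) ≠ ⟨1, by omega⟩ := by simp
  by_cases h : AddSubgroup.closure (Set.range b) = ⊤
  · have h₁ := (closure_range_update_sub b h01).trans h
    have h₂ := (closure_range_update_sub b h01.symm).trans h
    rw [extSymb_of_closure_eq_top h, extSymb_of_closure_eq_top h₁, extSymb_of_closure_eq_top h₂]
    exact symb_blowup hn _ _ _ rfl rfl
  · rw [extSymb, extSymb, extSymb, dif_neg h, dif_neg (by rwa [closure_range_update_sub b h01]),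
      dif_neg (by rwa [closure_range_update_sub b h01.symm]), add_zero]

variable {B : AddSubgroup A}

theorem extSymbm_of_closure_ne {b : Fin n → A} (h : AddSubgroup.closure (Set.range b) ≠ B) :
    extSymbm n B b = 0 :=
  dif_neg h

theorem extSymbm_coe (β : GenTuple n B) :
    extSymbm n B (fun i => (β.1 i : A)) = symbm n B β :=
  dif_pos ((closure_range_coe_eq_iff _).2 β.2)

theorem extSymbm_comp_perm (b : Fin n → A) (σ : Equiv.Perm (Fin n)) :
    extSymbm n B (b ∘ σ) = extSymbm n B b := by
  by_cases h : AddSubgroup.closure (Set.range b) = B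
  · have h' := (closure_range_comp_perm b σ).trans h
    rw [extSymbm, extSymbm, dif_pos h, dif_pos h']
    exact (symbm_eq_of_perm _ _ σ rfl).symm
  · rw [extSymbm, extSymbm, dif_neg h, dif_neg (by rwa [closure_range_comp_perm])]

theorem extSymbm_blowup (b : Fin n → A) {i j : Fin n} (hij : i ≠ j) :
    extSymbm n B b = extSymbm n B (Function.update b i (b i - b j)) +
      extSymbm n B (Function.update b j (b j - b i)) := by
  refine blowup_of_blowup_zero_one extSymbm_comp_perm (fun hn b => ?_) b hij
  have h01 : (⟨0, by omega⟩ : Fin n) ≠ ⟨1, by omega⟩ := by simp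
  by_cases h : AddSubgroup.closure (Set.range b) = B
  · have h₁ := (closure_range_update_sub b h01).trans h
    have h₂ := (closure_range_update_sub b h01.symm).trans h
    rw [extSymbm, extSymbm, extSymbm, dif_pos h, dif_pos h₁, dif_pos h₂]
    refine symbm_blowup hn _ _ _ ?_ ?_
    all_goals
      funext k
      apply Subtype.ext
      simp only [Function.update_apply]
      split_ifs <;> rfl
  · rw [extSymbm, extSymbm, extSymbm, dif_neg h,
      dif_neg (by rwa [closure_range_update_sub b h01]),
      dif_neg (by rwa [closure_range_update_sub b h01.symm]), add_zero]

theorem extSymbm_update_neg (b : Fin n → A) (i : Fin n) :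
    extSymbm n B (Function.update b i (-b i)) = -extSymbm n B b := by
  have hn : 1 ≤ n := i.pos
  set z : Fin n := ⟨0, by omega⟩
  have key (b : Fin n → A) :
      extSymbm n B (Function.update b z (-b z)) = -extSymbm n B b := by
    by_cases h : AddSubgroup.closure (Set.range b) = B
    · have h' := (closure_range_update_neg b z).trans h
      rw [eq_neg_iff_add_eq_zero, add_comm, extSymbm, extSymbm, dif_pos h, dif_pos h']
      refine symbm_add_update_neg hn _ _ ?_
      funext k
      apply Subtype.ext
      simp only [Function.update_apply]
      split_ifs <;> rfl
    · rw [extSymbm, extSymbm, dif_neg h, dif_neg (by rwa [closure_range_update_neg]), neg_zero]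
  have h := key (b ∘ Equiv.swap z i)
  simpa only [update_comp_perm, extSymbm_comp_perm, Function.comp_apply,
    Equiv.swap_apply_left] using h

theorem extSymbP_neg (a : A) : extSymbP A (-a) = extSymbP A a := by
  have hneg : AddSubgroup.closure {-a} = AddSubgroup.closure {a} := by
    rw [← Set.neg_singleton, AddSubgroup.closure_neg]
  by_cases h : AddSubgroup.closure {a} = ⊤
  · rw [extSymbP, extSymbP, dif_pos h, dif_pos (hneg.trans h)]
    exact (symbP_eq_of_neg _ _ rfl).symm
  · rw [extSymbP, extSymbP, dif_neg h, dif_neg (by rwa [hneg])]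

theorem closure_singleton_coe_eq_top (α : GenTuple 1 A) : AddSubgroup.closure {α.1 0} = ⊤ := by
  have h := α.2
  rwa [Set.range_unique, Fin.default_eq_zero] at h

theorem extSymbP_coe (α : GenTuple 1 A) : extSymbP A (α.1 0) = symbP A α := by
  rw [extSymbP, dif_pos (closure_singleton_coe_eq_top α)]
  congr 1
  refine Subtype.ext (funext fun i => ?_)
  rw [Subsingleton.elim i 0]

end Symbols

section Lifts

variable {n : ℕ} {A : Type} [AddCommGroup A] {V : Type*} [AddCommGroup V]

/-- The homomorphism out of `M_n(A)` induced by a function of tuples satisfying (O) and (M). -/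
def Mn.lift (f : (Fin n → A) → V) (hperm : ∀ b (σ : Equiv.Perm (Fin n)), f (b ∘ σ) = f b)
    (hblow : ∀ b (i j : Fin n), i ≠ j → f b =
      f (Function.update b i (b i - b j)) + f (Function.update b j (b j - b i))) :
    Mn n A →+ V :=
  QuotientAddGroup.lift _ (FreeAbelianGroup.lift fun β : GenTuple n A => f β.1) (by
    rw [AddSubgroup.closure_le]
    rintro x (⟨β, β', σ, h, rfl⟩ | ⟨hn, β, β₁, β₂, h₁, h₂, rfl⟩)
    · simp [h, hperm]
    · simp [h₁, h₂, sub_sub, ← hblow β.1 ⟨0, by omega⟩ ⟨1, by omega⟩ (by simp)])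

theorem Mn.lift_symb (f : (Fin n → A) → V) (hperm) (hblow) (β : GenTuple n A) :
    Mn.lift f hperm hblow (symb n A β) = f β.1 :=
  FreeAbelianGroup.lift_apply_of _ _

/-- The homomorphism out of `M_n⁻(A)` induced by a function of tuples satisfying (O), (M)
and (A). -/
def MnMinus.lift (f : (Fin n → A) → V) (hperm : ∀ b (σ : Equiv.Perm (Fin n)), f (b ∘ σ) = f b)
    (hblow : ∀ b (i j : Fin n), i ≠ j → f b =
      f (Function.update b i (b i - b j)) + f (Function.update b j (b j - b i)))
    (hneg : ∀ b (i : Fin n), f b + f (Function.update b i (-b i)) = 0) :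
    MnMinus n A →+ V :=
  QuotientAddGroup.lift _ (FreeAbelianGroup.lift fun β : GenTuple n A => f β.1) (by
    rw [AddSubgroup.closure_le]
    rintro x ((⟨β, β', σ, h, rfl⟩ | ⟨hn, β, β₁, β₂, h₁, h₂, rfl⟩) | ⟨hn, β, β', h, rfl⟩)
    · simp [h, hperm]
    · simp [h₁, h₂, sub_sub, ← hblow β.1 ⟨0, by omega⟩ ⟨1, by omega⟩ (by simp)]
    · simp [h, hneg])

theorem MnMinus.lift_symbm (f : (Fin n → A) → V) (hperm) (hblow) (hneg) (β : GenTuple n A) :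
    MnMinus.lift f hperm hblow hneg (symbm n A β) = f β.1 :=
  FreeAbelianGroup.lift_apply_of _ _

/-- The homomorphism out of `M₁⁺(A)` induced by an even function. -/
def M1Plus.lift (f : A → V) (hneg : ∀ a, f (-a) = f a) : M1Plus A →+ V :=
  QuotientAddGroup.lift _ (FreeAbelianGroup.lift fun β : GenTuple 1 A => f (β.1 0)) (by
    rw [AddSubgroup.closure_le]
    rintro x ((⟨β, β', σ, h, rfl⟩ | ⟨hn, _⟩) | ⟨β, β', h, rfl⟩)
    · simp [h, Subsingleton.elim (σ 0) 0]
    · omega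
    · simp [h, hneg])

theorem M1Plus.lift_symbP (f : A → V) (hneg) (β : GenTuple 1 A) :
    M1Plus.lift f hneg (symbP A β) = f (β.1 0) :=
  FreeAbelianGroup.lift_apply_of _ _

theorem MnMinus.induction_on {P : MnMinus n A → Prop} (x : MnMinus n A)
    (symbm : ∀ β, P (symbm n A β)) (zero : P 0) (neg : ∀ x, P x → P (-x))
    (add : ∀ x y, P x → P y → P (x + y)) : P x := by
  induction x using QuotientAddGroup.induction_on with
  | _ y =>
    induction y using FreeAbelianGroup.induction_on with
    | zero => exact zero
    | of β => exact symbm β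
    | neg β => exact neg _ (symbm β)
    | add x y hx hy => exact add _ _ hx hy

theorem M1Plus.induction_on {P : M1Plus A → Prop} (x : M1Plus A)
    (symbP : ∀ β, P (symbP A β)) (zero : P 0) (neg : ∀ x, P x → P (-x))
    (add : ∀ x y, P x → P y → P (x + y)) : P x := by
  induction x using QuotientAddGroup.induction_on with
  | _ y =>
    induction y using FreeAbelianGroup.induction_on with
    | zero => exact zero
    | of β => exact symbP β
    | neg β => exact neg _ (symbP β)
    | add x y hx hy => exact add _ _ hx hy

theorem MnMinus.hom_ext {f g : MnMinus n A →+ V}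
    (h : ∀ β, f (symbm n A β) = g (symbm n A β)) : f = g := by
  ext x
  induction x using MnMinus.induction_on with
  | symbm β => exact h β
  | zero => simp
  | neg x hx => simp [hx]
  | add x y hx hy => simp [hx, hy]

end Lifts

open TensorProduct

variable {A : Type} [AddCommGroup A] {m : ℕ}

variable (A) in
/-- The nonzero subgroups `B` of `A` with `A/B` cyclic. -/
abbrev CocyclicSubgroup : Type := {B : AddSubgroup A // B ≠ ⊥ ∧ IsAddCyclic (A ⧸ B)}

variable (m) in
/-- The summand `(M₁⁺(A/B) ⊗ M_m⁻(B)) ⊗ ℚ`. -/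
abbrev Summand (B : CocyclicSubgroup A) : Type :=
  ℚ ⊗[ℤ] (M1Plus (A ⧸ B.1) ⊗[ℤ] MnMinus m B.1)

section SymmetrizedSymbol

/-- The element `½(⟨a, b₁,…,b_m⟩ + ⟨-a, b₁,…,b_m⟩)` of `M_{m+1}(A) ⊗ ℚ`. -/
noncomputable def symmSymb (a : A) (b : Fin m → A) : ℚ ⊗[ℤ] Mn (m + 1) A :=
  ((1 : ℚ) / 2) ⊗ₜ[ℤ]
    (extSymb (m + 1) A (Fin.cons a b) + extSymb (m + 1) A (Fin.cons (-a) b))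

theorem symmSymb_neg (a : A) (b : Fin m → A) : symmSymb (-a) b = symmSymb a b := by
  rw [symmSymb, symmSymb, neg_neg, add_comm (extSymb _ _ _)]

theorem cons_comp_perm {X : Type*} (a : X) (b : Fin m → X) (σ : Equiv.Perm (Fin m)) :
    (Fin.cons a (b ∘ σ) : Fin (m + 1) → X) =
      (Fin.cons a b : Fin (m + 1) → X) ∘ Equiv.Perm.decomposeFin.symm (0, σ) := by
  funext k
  refine Fin.cases ?_ (fun k => ?_) k <;> simp

theorem symmSymb_comp_perm (a : A) (b : Fin m → A) (σ : Equiv.Perm (Fin m)) :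
    symmSymb a (b ∘ σ) = symmSymb a b := by
  rw [symmSymb, symmSymb, cons_comp_perm, cons_comp_perm, extSymb_comp_perm, extSymb_comp_perm]

theorem extSymb_cons_blowup (a : A) (b : Fin m → A) {i j : Fin m} (hij : i ≠ j) :
    extSymb (m + 1) A (Fin.cons a b) =
      extSymb (m + 1) A (Fin.cons a (Function.update b i (b i - b j))) +
      extSymb (m + 1) A (Fin.cons a (Function.update b j (b j - b i))) := by
  have h := extSymb_blowup (Fin.cons a b : Fin (m + 1) → A)
    (fun h => hij (Fin.succ_injective _ h) : i.succ ≠ j.succ)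
  rwa [Fin.cons_succ, Fin.cons_succ, ← Fin.cons_update, ← Fin.cons_update] at h

theorem symmSymb_blowup (a : A) (b : Fin m → A) {i j : Fin m} (hij : i ≠ j) :
    symmSymb a b = symmSymb a (Function.update b i (b i - b j)) +
      symmSymb a (Function.update b j (b j - b i)) := by
  rw [symmSymb, symmSymb, symmSymb, extSymb_cons_blowup a b hij, extSymb_cons_blowup (-a) b hij,
    ← TensorProduct.tmul_add]
  congr 1
  abel

theorem extSymb_cons_update_swap (b : Fin m → A) (j : Fin m) (x y : A) :
    extSymb (m + 1) A (Fin.cons x (Function.update b j y)) =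
      extSymb (m + 1) A (Fin.cons y (Function.update b j x)) := by
  rw [← extSymb_comp_perm (Fin.cons y (Function.update b j x)) (Equiv.swap 0 j.succ)]
  congr 1
  funext k
  refine Fin.cases ?_ (fun k => ?_) k
  · simp
  · rcases eq_or_ne k j with rfl | hk
    · rw [Function.comp_apply, Equiv.swap_apply_right, Fin.cons_zero, Fin.cons_succ,
        Function.update_self]
    · rw [Function.comp_apply, Equiv.swap_apply_of_ne_of_ne (Fin.succ_ne_zero k)
        (fun h => hk (Fin.succ_injective _ h))]
      simp [hk]

theorem extSymb_cons_update_blowup (b : Fin m → A) (j : Fin m) (x y : A) :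
    extSymb (m + 1) A (Fin.cons x (Function.update b j y)) =
      extSymb (m + 1) A (Fin.cons (x - y) (Function.update b j y)) +
      extSymb (m + 1) A (Fin.cons x (Function.update b j (y - x))) := by
  have h := extSymb_blowup (Fin.cons x (Function.update b j y) : Fin (m + 1) → A)
    (Fin.succ_ne_zero j).symm
  rwa [Fin.cons_succ, Fin.cons_zero, Function.update_self, Fin.update_cons_zero,
    ← Fin.cons_update, Function.update_idem] at h

theorem symmSymb_sub (a : A) (b : Fin m → A) (j : Fin m) :
    symmSymb (a - b j) b = symmSymb a b := by
  have h := pair_add_neg_sub_right (extSymb_cons_update_swap b j)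
    (extSymb_cons_update_blowup b j) a (b j)
  simp only [Function.update_eq_self] at h
  rw [symmSymb, symmSymb, h]

theorem symmSymb_add_of_mem {x : A} {b : Fin m → A} (hx : x ∈ AddSubgroup.closure (Set.range b))
    (a : A) : symmSymb (a + x) b = symmSymb a b := by
  induction hx using AddSubgroup.closure_induction generalizing a with
  | mem x hx =>
    obtain ⟨j, rfl⟩ := hx
    rw [← symmSymb_sub _ b j, add_sub_cancel_right]
  | zero => rw [add_zero]
  | add x y _ _ hx hy => rw [← add_assoc, hy, hx]
  | neg x _ hx => rw [← hx, neg_add_cancel_right]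

theorem symmSymb_update_add_update_neg [Finite A] (b : Fin m → A) (j : Fin m) (x y : A) :
    symmSymb x (Function.update b j y) + symmSymb x (Function.update b j (-y)) = 0 := by
  have h := pair_sum_signs_eq_zero (V := ℚ ⊗[ℤ] Mn (m + 1) A)
    (G := fun x y => ((1 : ℚ) / 2) ⊗ₜ[ℤ]
      extSymb (m + 1) A (Fin.cons x (Function.update b j y)))
    (fun x y => by rw [extSymb_cons_update_swap])
    (fun x y => by rw [extSymb_cons_update_blowup, TensorProduct.tmul_add]) x y
  simpa only [symmSymb, TensorProduct.tmul_add] using h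

theorem symmSymb_add_update_neg [Finite A] (a : A) (b : Fin m → A) (j : Fin m) :
    symmSymb a b + symmSymb a (Function.update b j (-b j)) = 0 := by
  simpa only [Function.update_eq_self] using symmSymb_update_add_update_neg b j a (b j)

theorem symmSymb_zero_right [Finite A] (hm : 1 ≤ m) (a : A) :
    symmSymb a (0 : Fin m → A) = 0 := by
  have h := symmSymb_add_update_neg a (0 : Fin m → A) ⟨0, hm⟩
  rw [Pi.zero_apply, neg_zero, ← Pi.zero_apply (M := fun _ => A) (⟨0, hm⟩ : Fin m),
    Function.update_eq_self, ← two_smul ℚ] at h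
  exact (smul_eq_zero.1 h).resolve_left two_ne_zero

end SymmetrizedSymbol

section Coproduct

variable (B : CocyclicSubgroup A)

/-- The element `⟨a mod B⟩⁺ ⊗ ⟨b₁,…,b_m⟩⁻`; it is zero if `b₁,…,b_m` do not generate `B`. -/
noncomputable def splitSymb (a : A) (b : Fin m → A) : Summand m B :=
  (1 : ℚ) ⊗ₜ[ℤ] (extSymbP (A ⧸ B.1) (QuotientAddGroup.mk a) ⊗ₜ[ℤ] extSymbm m B.1 b)

theorem splitSymb_comp_perm (a : A) (b : Fin m → A) (σ : Equiv.Perm (Fin m)) :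
    splitSymb B a (b ∘ σ) = splitSymb B a b := by
  rw [splitSymb, splitSymb, extSymbm_comp_perm]

theorem splitSymb_blowup (a : A) (b : Fin m → A) {i j : Fin m} (hij : i ≠ j) :
    splitSymb B a b = splitSymb B a (Function.update b i (b i - b j)) +
      splitSymb B a (Function.update b j (b j - b i)) := by
  simp only [splitSymb, ← TensorProduct.tmul_add, ← extSymbm_blowup b hij]

theorem splitSymb_update_neg (a : A) (b : Fin m → A) (i : Fin m) :
    splitSymb B a (Function.update b i (-b i)) = -splitSymb B a b := by
  simp only [splitSymb, extSymbm_update_neg, TensorProduct.tmul_neg]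

theorem splitSymb_neg (a : A) (b : Fin m → A) : splitSymb B (-a) b = splitSymb B a b := by
  rw [splitSymb, splitSymb, QuotientAddGroup.mk_neg, extSymbP_neg]

theorem splitSymb_eq_zero {a : A} {b : Fin m → A} (h : AddSubgroup.closure (Set.range b) ≠ B.1) :
    splitSymb B a b = 0 := by
  rw [splitSymb, extSymbm_of_closure_ne h, TensorProduct.tmul_zero, TensorProduct.tmul_zero]

theorem splitSymb_congr {a a' : A} {b : Fin m → A}
    (h : a - a' ∈ AddSubgroup.closure (Set.range b)) : splitSymb B a b = splitSymb B a' b := by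
  by_cases hB : AddSubgroup.closure (Set.range b) = B.1
  · rw [splitSymb, splitSymb, QuotientAddGroup.eq_iff_sub_mem.2 (hB ▸ h)]
  · rw [splitSymb_eq_zero B hB, splitSymb_eq_zero B hB]

theorem splitSymb_coe {a : A} (α : GenTuple 1 (A ⧸ B.1)) (β : GenTuple m B.1)
    (h : QuotientAddGroup.mk a = α.1 0) : splitSymb B a (fun i => (β.1 i : A)) =
      (1 : ℚ) ⊗ₜ[ℤ] (symbP (A ⧸ B.1) α ⊗ₜ[ℤ] symbm m B.1 β) := by
  rw [splitSymb, h, extSymbP_coe, extSymbm_coe]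

/-- The component of the coproduct of `⟨c₀,…,c_m⟩` splitting off one entry. -/
noncomputable def coprodSymb (c : Fin (m + 1) → A) : Summand m B :=
  ∑ i, splitSymb B (c i) (i.removeNth c)

theorem removeNth_comp_perm {X : Type*} (c : Fin (m + 1) → X) (σ : Equiv.Perm (Fin (m + 1)))
    (i : Fin (m + 1)) :
    ∃ τ : Equiv.Perm (Fin m), i.removeNth (c ∘ σ) = (σ i).removeNth c ∘ τ := by
  refine ⟨(finSuccAboveEquiv i).trans
    ((σ.subtypeEquiv fun j => by simp).trans (finSuccAboveEquiv (σ i)).symm), ?_⟩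
  funext j
  have h := (finSuccAboveEquiv (σ i)).apply_symm_apply
    (σ.subtypeEquiv (p := (· ≠ i)) (q := (· ≠ σ i)) (fun j => by simp) (finSuccAboveEquiv i j))
  exact congrArg (fun x => c x.1) h.symm

theorem coprodSymb_comp_perm (c : Fin (m + 1) → A) (σ : Equiv.Perm (Fin (m + 1))) :
    coprodSymb B (c ∘ σ) = coprodSymb B c := by
  rw [coprodSymb, coprodSymb, ← Equiv.sum_comp σ fun i => splitSymb B (c i) (i.removeNth c)]
  refine Finset.sum_congr rfl fun i _ => ?_
  obtain ⟨τ, hτ⟩ := removeNth_comp_perm c σ i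
  rw [hτ, splitSymb_comp_perm, Function.comp_apply]

theorem removeNth_update_succAbove {X : Type*} (c : Fin (m + 1) → X) (i : Fin (m + 1)) (j : Fin m)
    (x : X) : i.removeNth (Function.update c (i.succAbove j) x) =
      Function.update (i.removeNth c) j x :=
  Function.update_comp_eq_of_injective c Fin.succAbove_right_injective j x

theorem mem_closure_range_removeNth (c : Fin (m + 1) → A) {i j : Fin (m + 1)} (h : j ≠ i) :
    c j ∈ AddSubgroup.closure (Set.range (i.removeNth c)) := by
  obtain ⟨k, rfl⟩ := Fin.exists_succAbove_eq h
  exact mem_closure_range (i.removeNth c) k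

theorem splitSymb_removeNth_blowup (c : Fin (m + 1) → A) {i p q : Fin (m + 1)} (hp : p ≠ i)
    (hq : q ≠ i) (hpq : p ≠ q) : splitSymb B (c i) (i.removeNth c) =
      splitSymb B (c i) (i.removeNth (Function.update c p (c p - c q))) +
      splitSymb B (c i) (i.removeNth (Function.update c q (c q - c p))) := by
  obtain ⟨p, rfl⟩ := Fin.exists_succAbove_eq hp
  obtain ⟨q, rfl⟩ := Fin.exists_succAbove_eq hq
  rw [removeNth_update_succAbove, removeNth_update_succAbove]
  exact splitSymb_blowup B _ _ fun h => hpq (by rw [h])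

theorem coprodSymb_blowup_zero_one (c : Fin (m + 2) → A) :
    coprodSymb B c = coprodSymb B (Function.update c 0 (c 0 - c 1)) +
      coprodSymb B (Function.update c 1 (c 1 - c 0)) := by
  have h01 : (0 : Fin (m + 2)) ≠ 1 := by simp
  set c₀ := Function.update c 0 (c 0 - c 1) with hc₀
  set c₁ := Function.update c 1 (c 1 - c 0) with hc₁
  have h₀ : splitSymb B (c₀ 0) (Fin.removeNth 0 c₀) = splitSymb B (c 0) (Fin.removeNth 0 c) := by
    rw [hc₀, Fin.removeNth_update, Function.update_self]
    refine splitSymb_congr B ?_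
    rw [sub_sub_cancel_left]
    exact neg_mem (mem_closure_range_removeNth c h01.symm)
  have h₁ : splitSymb B (c₁ 1) (Fin.removeNth 1 c₁) = splitSymb B (c 1) (Fin.removeNth 1 c) := by
    rw [hc₁, Fin.removeNth_update, Function.update_self]
    refine splitSymb_congr B ?_
    rw [sub_sub_cancel_left]
    exact neg_mem (mem_closure_range_removeNth c h01)
  have hcross : splitSymb B (c₀ 1) (Fin.removeNth 1 c₀) +
      splitSymb B (c₁ 0) (Fin.removeNth 0 c₁) = 0 := by
    have hrem : Fin.removeNth 0 c₁ =
        Function.update (Fin.removeNth 1 c₀) 0 (-Fin.removeNth 1 c₀ 0) := by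
      funext k
      refine Fin.cases ?_ (fun k => ?_) k
      · simp [Fin.removeNth_apply, hc₀, hc₁]
      · have : k.succ.succ ≠ (1 : Fin (m + 2)) := by simp [Fin.ext_iff]
        simp [Fin.removeNth_apply, hc₀, hc₁, this]
    have hmem : c₁ 0 - c₀ 1 ∈ AddSubgroup.closure (Set.range (Fin.removeNth 1 c₀)) := by
      have h := mem_closure_range_removeNth c₀ h01
      simpa [hc₀, hc₁, Function.update_of_ne h01, Function.update_of_ne h01.symm] using h
    rw [hrem, splitSymb_update_neg, splitSymb_congr B hmem, add_neg_cancel]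
  have hrest (i : Fin m) : splitSymb B (c i.succ.succ) (i.succ.succ.removeNth c) =
      splitSymb B (c₀ i.succ.succ) (i.succ.succ.removeNth c₀) +
      splitSymb B (c₁ i.succ.succ) (i.succ.succ.removeNth c₁) := by
    have hi₀ : i.succ.succ ≠ (0 : Fin (m + 2)) := Fin.succ_ne_zero _
    have hi₁ : i.succ.succ ≠ (1 : Fin (m + 2)) := by simp [Fin.ext_iff]
    rw [splitSymb_removeNth_blowup B c hi₀.symm hi₁.symm h01, hc₀, hc₁,
      Function.update_of_ne hi₀, Function.update_of_ne hi₁]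
  simp only [coprodSymb, Fin.sum_univ_succ, hrest, Finset.sum_add_distrib, Fin.succ_zero_eq_one]
  rw [h₀, h₁, ← sub_eq_zero, ← neg_eq_zero, ← hcross]
  abel

theorem coprodSymb_blowup (c : Fin (m + 1) → A) {i j : Fin (m + 1)} (hij : i ≠ j) :
    coprodSymb B c = coprodSymb B (Function.update c i (c i - c j)) +
      coprodSymb B (Function.update c j (c j - c i)) := by
  refine blowup_of_blowup_zero_one (coprodSymb_comp_perm B) (fun hn c => ?_) c hij
  obtain ⟨k, rfl⟩ : ∃ k, m = k + 1 := ⟨m - 1, by omega⟩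
  exact coprodSymb_blowup_zero_one B c

variable (m) in
/-- The component of the coproduct splitting off one entry, as a linear map. -/
noncomputable def coprod :
    ℚ ⊗[ℤ] Mn (m + 1) A →ₗ[ℚ] Summand m B :=
  LinearMap.liftBaseChange ℚ (Mn.lift (coprodSymb B) (coprodSymb_comp_perm B)
    fun c _ _ hij => coprodSymb_blowup B c hij).toIntLinearMap

theorem coprod_tmul_symb (q : ℚ) (β : GenTuple (m + 1) A) :
    coprod m B (q ⊗ₜ[ℤ] symb (m + 1) A β) = q • coprodSymb B β.1 := by
  rw [coprod, LinearMap.liftBaseChange_tmul]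
  exact congrArg (q • ·) (Mn.lift_symb (coprodSymb B) (coprodSymb_comp_perm B)
    (fun c _ _ hij => coprodSymb_blowup B c hij) β)

theorem coprod_tmul_extSymb (q : ℚ) {c : Fin (m + 1) → A}
    (h : AddSubgroup.closure (Set.range c) = ⊤) :
    coprod m B (q ⊗ₜ[ℤ] extSymb (m + 1) A c) = q • coprodSymb B c := by
  rw [extSymb_of_closure_eq_top h]
  exact coprod_tmul_symb B q ⟨c, h⟩

theorem splitSymb_removeNth_succ_cons_neg (a : A) (b : Fin m → A) (i : Fin m) :
    splitSymb B (b i) (i.succ.removeNth (Fin.cons a b : Fin (m + 1) → A)) +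
      splitSymb B (b i) (i.succ.removeNth (Fin.cons (-a) b : Fin (m + 1) → A)) = 0 := by
  obtain ⟨k, rfl⟩ : ∃ k, m = k + 1 := ⟨m - 1, by have := i.pos; omega⟩
  have h : i.succ.removeNth (Fin.cons (-a) b : Fin (k + 2) → A) =
      Function.update (i.succ.removeNth (Fin.cons a b : Fin (k + 2) → A)) 0
        (-i.succ.removeNth (Fin.cons a b : Fin (k + 2) → A) 0) := by
    funext j
    refine Fin.cases ?_ (fun j => ?_) j <;> simp [Fin.removeNth_apply]
  rw [h, splitSymb_update_neg, add_neg_cancel]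

theorem coprodSymb_cons_add_neg (a : A) (b : Fin m → A) :
    coprodSymb B (Fin.cons a b) + coprodSymb B (Fin.cons (-a) b) =
      splitSymb B a b + splitSymb B a b := by
  simp only [coprodSymb, Fin.sum_univ_succ, Fin.cons_zero, Fin.cons_succ, Fin.removeNth_zero,
    Fin.tail_cons, splitSymb_neg]
  rw [add_add_add_comm, ← Finset.sum_add_distrib,
    Finset.sum_eq_zero fun i _ => splitSymb_removeNth_succ_cons_neg B a b i, add_zero]

theorem coprod_symmSymb {a : A} {b : Fin m → A}
    (h : AddSubgroup.closure {a} ⊔ AddSubgroup.closure (Set.range b) = ⊤) :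
    coprod m B (symmSymb a b) = splitSymb B a b := by
  have h₁ := (closure_range_cons a b).trans h
  have h₂ := (closure_range_cons_neg a b).trans h
  rw [symmSymb, TensorProduct.tmul_add, map_add, coprod_tmul_extSymb B _ h₁,
    coprod_tmul_extSymb B _ h₂, ← smul_add,
    coprodSymb_cons_add_neg, ← two_smul ℚ, smul_smul]
  norm_num

end Coproduct

section Gluing

theorem Summand.induction_on {B : CocyclicSubgroup A} {P : Summand m B → Prop} (x : Summand m B)
    (symb : ∀ α β, P ((1 : ℚ) ⊗ₜ[ℤ] (symbP (A ⧸ B.1) α ⊗ₜ[ℤ] symbm m B.1 β)))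
    (zero : P 0) (add : ∀ x y, P x → P y → P (x + y)) (smul : ∀ (q : ℚ) x, P x → P (q • x)) :
    P x := by
  have neg (x) (hx : P x) : P (-x) := neg_one_smul ℚ x ▸ smul (-1) x hx
  induction x using TensorProduct.induction_on with
  | zero => exact zero
  | add x y hx hy => exact add x y hx hy
  | tmul q y =>
    rw [← mul_one q, ← smul_eq_mul, ← TensorProduct.smul_tmul']
    refine smul q _ ?_
    induction y using TensorProduct.induction_on with
    | zero => rwa [TensorProduct.tmul_zero]
    | add x y hx hy =>
      rw [TensorProduct.tmul_add]
      exact add _ _ hx hy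
    | tmul u v =>
      induction u using M1Plus.induction_on with
      | zero => rwa [TensorProduct.zero_tmul, TensorProduct.tmul_zero]
      | neg u hu =>
        rw [TensorProduct.neg_tmul, TensorProduct.tmul_neg]
        exact neg _ hu
      | add u u' hu hu' =>
        rw [TensorProduct.add_tmul, TensorProduct.tmul_add]
        exact add _ _ hu hu'
      | symbP α =>
        induction v using MnMinus.induction_on with
        | zero => rwa [TensorProduct.tmul_zero, TensorProduct.tmul_zero]
        | neg v hv =>
          rw [TensorProduct.tmul_neg, TensorProduct.tmul_neg]
          exact neg _ hv
        | add v v' hv hv' =>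
          rw [TensorProduct.tmul_add, TensorProduct.tmul_add]
          exact add _ _ hv hv'
        | symbm β => exact symb α β

theorem closure_singleton_sup_eq_top {B : AddSubgroup A} {a : A} (α : GenTuple 1 (A ⧸ B))
    (β : GenTuple m B) (h : QuotientAddGroup.mk a = α.1 0) :
    AddSubgroup.closure {a} ⊔ AddSubgroup.closure (Set.range fun i => (β.1 i : A)) = ⊤ := by
  rw [(closure_range_coe_eq_iff _).2 β.2, ← closure_singleton_mk_eq_top_iff, h,
    closure_singleton_coe_eq_top]

variable [Finite A]

variable (m) in
/-- The homomorphism `⟨b₁,…,b_m⟩⁻ ↦ ½(⟨a, b₁,…,b_m⟩ + ⟨-a, b₁,…,b_m⟩)` on `M_m⁻(B)`. -/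
noncomputable def glueRight (B : AddSubgroup A) (a : A) : MnMinus m B →+ ℚ ⊗[ℤ] Mn (m + 1) A :=
  MnMinus.lift (fun b => symmSymb a fun i => (b i : A))
    (fun b σ => symmSymb_comp_perm a (fun i => (b i : A)) σ)
    (fun b i j hij => by
      rw [symmSymb_blowup a _ hij]
      congr 2 <;> funext k <;> simp only [Function.update_apply] <;> split_ifs <;> rfl)
    (fun b i => by
      rw [← symmSymb_add_update_neg a (fun k => (b k : A)) i]
      congr 2
      funext k
      simp only [Function.update_apply]
      split_ifs <;> rfl)

theorem glueRight_symbm (B : AddSubgroup A) (a : A) (β : GenTuple m B) :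
    glueRight m B a (symbm m B β) = symmSymb a fun i => (β.1 i : A) :=
  MnMinus.lift_symbm ..

theorem glueRight_neg (B : AddSubgroup A) (a : A) : glueRight m B (-a) = glueRight m B a :=
  MnMinus.hom_ext fun β => by rw [glueRight_symbm, glueRight_symbm, symmSymb_neg]

theorem glueRight_congr {B : AddSubgroup A} {a a' : A}
    (h : (QuotientAddGroup.mk a : A ⧸ B) = QuotientAddGroup.mk a') :
    glueRight m B a = glueRight m B a' :=
  MnMinus.hom_ext fun β => by
    have hmem : -a + a' ∈ AddSubgroup.closure (Set.range fun i => (β.1 i : A)) := by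
      rw [(closure_range_coe_eq_iff _).2 β.2]
      exact QuotientAddGroup.eq.1 h
    rw [glueRight_symbm, glueRight_symbm, ← symmSymb_add_of_mem hmem, add_neg_cancel_left]

variable (m) in
/-- The homomorphism `⟨a⟩⁺ ↦ ⟨b₁,…,b_m⟩⁻ ↦ ½(⟨ã, b₁,…,b_m⟩ + ⟨-ã, b₁,…,b_m⟩)` on `M₁⁺(A/B)`. -/
noncomputable def glueLeft (B : AddSubgroup A) :
    M1Plus (A ⧸ B) →+ (MnMinus m B →+ ℚ ⊗[ℤ] Mn (m + 1) A) :=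
  M1Plus.lift (fun x => glueRight m B x.out) fun x => by
    rw [← glueRight_neg]
    refine glueRight_congr ?_
    rw [QuotientAddGroup.mk_neg, QuotientAddGroup.out_eq', QuotientAddGroup.out_eq', neg_neg]

theorem glueLeft_symbP_symbm (B : AddSubgroup A) {a : A} (α : GenTuple 1 (A ⧸ B))
    (β : GenTuple m B) (h : QuotientAddGroup.mk a = α.1 0) :
    glueLeft m B (symbP (A ⧸ B) α) (symbm m B β) = symmSymb a fun i => (β.1 i : A) := by
  rw [glueLeft, M1Plus.lift_symbP, ← glueRight_symbm, ← h]
  congr 1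
  exact glueRight_congr (QuotientAddGroup.out_eq' _)

variable (m) in
/-- The restriction of `ψ` to the summand of `B`, with values in `M_{m+1}(A) ⊗ ℚ`. -/
noncomputable def glueSummand (B : CocyclicSubgroup A) :
    Summand m B →ₗ[ℚ] ℚ ⊗[ℤ] Mn (m + 1) A :=
  LinearMap.liftBaseChange ℚ (TensorProduct.liftAddHom (glueLeft m B.1)
    (fun r x y => by rw [map_zsmul, map_zsmul, AddMonoidHom.zsmul_apply])).toIntLinearMap

theorem glueSummand_symb (B : CocyclicSubgroup A) {a : A} (α : GenTuple 1 (A ⧸ B.1))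
    (β : GenTuple m B.1) (h : QuotientAddGroup.mk a = α.1 0) :
    glueSummand m B ((1 : ℚ) ⊗ₜ[ℤ] (symbP (A ⧸ B.1) α ⊗ₜ[ℤ] symbm m B.1 β)) =
      symmSymb a fun i => (β.1 i : A) := by
  rw [glueSummand, LinearMap.liftBaseChange_tmul, one_smul]
  exact glueLeft_symbP_symbm B.1 α β h

theorem coprod_glueSummand_self (B : CocyclicSubgroup A) (x : Summand m B) :
    coprod m B (glueSummand m B x) = x := by
  induction x using Summand.induction_on with
  | zero => simp
  | add x y hx hy => rw [map_add, map_add, hx, hy]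
  | smul q x hx => rw [map_smul, map_smul, hx]
  | symb α β =>
    obtain ⟨a, ha⟩ := QuotientAddGroup.mk_surjective (α.1 0)
    rw [glueSummand_symb B α β ha, coprod_symmSymb B (closure_singleton_sup_eq_top α β ha),
      splitSymb_coe B α β ha]

theorem coprod_glueSummand_of_ne {B B' : CocyclicSubgroup A} (h : B ≠ B') (x : Summand m B) :
    coprod m B' (glueSummand m B x) = 0 := by
  induction x using Summand.induction_on with
  | zero => simp
  | add x y hx hy => rw [map_add, map_add, hx, hy, add_zero]
  | smul q x hx => rw [map_smul, map_smul, hx, smul_zero]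
  | symb α β =>
    obtain ⟨a, ha⟩ := QuotientAddGroup.mk_surjective (α.1 0)
    rw [glueSummand_symb B α β ha, coprod_symmSymb B' (closure_singleton_sup_eq_top α β ha),
      splitSymb_eq_zero]
    rw [(closure_range_coe_eq_iff _).2 β.2]
    exact fun hB => h (Subtype.ext hB)

variable (A m) in
/-- The map `ψ` with values in `M_{m+1}(A) ⊗ ℚ`. -/
noncomputable def glue [DecidableEq (CocyclicSubgroup A)] :
    DirectSum (CocyclicSubgroup A) (fun B => Summand m B) →ₗ[ℚ] ℚ ⊗[ℤ] Mn (m + 1) A :=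
  DirectSum.toModule ℚ _ _ (glueSummand m)

variable [DecidableEq (CocyclicSubgroup A)]

theorem glue_injective : Function.Injective (glue A m) := by
  have h (B : CocyclicSubgroup A) :
      coprod m B ∘ₗ glue A m = DirectSum.component ℚ _ (fun B => Summand m B) B := by
    refine DirectSum.linearMap_ext ℚ fun B' => LinearMap.ext fun x => ?_
    simp only [LinearMap.comp_apply, glue, DirectSum.toModule_lof]
    rcases eq_or_ne B' B with rfl | hB
    · rw [coprod_glueSummand_self, DirectSum.component.lof_self]
    · rw [coprod_glueSummand_of_ne hB, DirectSum.component.of, dif_neg hB]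
  intro x y hxy
  refine DFinsupp.ext fun B => ?_
  have hB := congrArg (coprod m B) hxy
  exact (LinearMap.congr_fun (h B) x).symm.trans (hB.trans (LinearMap.congr_fun (h B) y))

end Gluing

section Range

variable (A) in
/-- The inclusion of `K_n(A) ⊗ ℚ` into `M_n(A) ⊗ ℚ`. -/
noncomputable def kernelInclusion (n : ℕ) : ℚ ⊗[ℤ] Kn n A →ₗ[ℚ] ℚ ⊗[ℤ] Mn n A :=
  (Kn n A).subtype.toIntLinearMap.baseChange ℚ

theorem kernelInclusion_injective (n : ℕ) : Function.Injective (kernelInclusion A n) :=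
  Module.Flat.lTensor_preserves_injective_linearMap (M := ℚ) (Kn n A).subtype.toIntLinearMap
    (Kn n A).subtype_injective

theorem kernelInclusion_tmul {n : ℕ} (q : ℚ) (k : Kn n A) :
    kernelInclusion A n (q ⊗ₜ[ℤ] k) = q ⊗ₜ[ℤ] (k : Mn n A) :=
  rfl

theorem symb_add_symb_mem_Kn (β β' : GenTuple (m + 1) A)
    (h : β'.1 = Function.update β.1 0 (-β.1 0)) :
    symb (m + 1) A β + symb (m + 1) A β' ∈ Kn (m + 1) A :=
  symbm_add_update_neg (by omega) β β' h

theorem symmSymb_mem_range_kernelInclusion {a : A} {b : Fin m → A}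
    (h : AddSubgroup.closure {a} ⊔ AddSubgroup.closure (Set.range b) = ⊤) :
    symmSymb a b ∈ LinearMap.range (kernelInclusion A (m + 1)) := by
  have h₁ := (closure_range_cons a b).trans h
  have h₂ := (closure_range_cons_neg a b).trans h
  rw [symmSymb, extSymb_of_closure_eq_top h₁, extSymb_of_closure_eq_top h₂]
  have h : (Fin.cons (-a) b : Fin (m + 1) → A) =
      Function.update (Fin.cons a b : Fin (m + 1) → A) 0 (-a) :=
    (Fin.update_cons_zero ..).symm
  exact ⟨(1 / 2 : ℚ) ⊗ₜ[ℤ] ⟨_, symb_add_symb_mem_Kn ⟨_, h₁⟩ ⟨_, h₂⟩ h⟩, rfl⟩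

variable [Finite A]

theorem glueSummand_mem_range_kernelInclusion (B : CocyclicSubgroup A) (x : Summand m B) :
    glueSummand m B x ∈ LinearMap.range (kernelInclusion A (m + 1)) := by
  induction x using Summand.induction_on with
  | zero => simp
  | add x y hx hy => rw [map_add]; exact add_mem hx hy
  | smul q x hx => rw [map_smul]; exact Submodule.smul_mem _ q hx
  | symb α β =>
    obtain ⟨a, ha⟩ := QuotientAddGroup.mk_surjective (α.1 0)
    rw [glueSummand_symb B α β ha]
    exact symmSymb_mem_range_kernelInclusion (closure_singleton_sup_eq_top α β ha)

theorem isAddCyclic_of_closure_singleton_eq_top {G : Type*} [AddCommGroup G] {g : G}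
    (h : AddSubgroup.closure {g} = ⊤) : IsAddCyclic G :=
  ⟨g, fun x => by
    have hx : x ∈ AddSubgroup.closure {g} := h ▸ AddSubgroup.mem_top x
    rwa [← AddSubgroup.zmultiples_eq_closure] at hx⟩

variable [DecidableEq (CocyclicSubgroup A)]

theorem symmSymb_mem_range_glue (hm : 1 ≤ m) {a : A} {b : Fin m → A}
    (h : AddSubgroup.closure {a} ⊔ AddSubgroup.closure (Set.range b) = ⊤) :
    symmSymb a b ∈ LinearMap.range (glue A m) := by
  set B := AddSubgroup.closure (Set.range b) with hB
  by_cases hbot : B = ⊥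
  · have hb : b = 0 := funext fun i => by
      rw [Pi.zero_apply, ← AddSubgroup.mem_bot, ← hbot]
      exact mem_closure_range b i
    rw [hb, symmSymb_zero_right hm]
    exact zero_mem _
  · have ha := (closure_singleton_mk_eq_top_iff a B).2 h
    have hcyc := isAddCyclic_of_closure_singleton_eq_top ha
    let α : GenTuple 1 (A ⧸ B) := ⟨fun _ => QuotientAddGroup.mk a, by rwa [Set.range_const]⟩
    let β : GenTuple m B := ⟨fun i => ⟨b i, mem_closure_range b i⟩,
      (closure_range_coe_eq_iff _).1 rfl⟩
    refine ⟨DirectSum.lof ℚ _ (fun B => Summand m B) ⟨B, hbot, hcyc⟩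
      ((1 : ℚ) ⊗ₜ[ℤ] (symbP (A ⧸ B) α ⊗ₜ[ℤ] symbm m B β)), ?_⟩
    rw [glue, DirectSum.toModule_lof]
    exact glueSummand_symb ⟨B, hbot, hcyc⟩ α β rfl

theorem one_tmul_symb_add_symb_mem_range_glue (hm : 1 ≤ m) (β β' : GenTuple (m + 1) A)
    (h : β'.1 = Function.update β.1 0 (-β.1 0)) :
    (1 : ℚ) ⊗ₜ[ℤ] (symb (m + 1) A β + symb (m + 1) A β') ∈ LinearMap.range (glue A m) := by
  have hβ : β.1 = Fin.cons (β.1 0) (Fin.tail β.1) := (Fin.cons_self_tail _).symm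
  have hβ' : β'.1 = Fin.cons (-β.1 0) (Fin.tail β.1) := by
    rw [h]
    conv_lhs => rw [hβ]
    rw [Fin.cons_zero, Fin.update_cons_zero]
  have hsymm : (1 : ℚ) ⊗ₜ[ℤ] (symb (m + 1) A β + symb (m + 1) A β') =
      (2 : ℚ) • symmSymb (β.1 0) (Fin.tail β.1) := by
    rw [symmSymb, ← hβ, ← hβ', extSymb_coe, extSymb_coe, TensorProduct.smul_tmul']
    norm_num
  rw [hsymm]
  refine Submodule.smul_mem _ _ (symmSymb_mem_range_glue hm ?_)
  rw [← closure_range_cons, ← hβ, β.2]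

theorem one_tmul_mem_range_glue (hm : 1 ≤ m) {k : Mn (m + 1) A} (hk : k ∈ Kn (m + 1) A) :
    (1 : ℚ) ⊗ₜ[ℤ] k ∈ LinearMap.range (glue A m) := by
  induction k using QuotientAddGroup.induction_on with
  | _ y =>
    have hy : y ∈ AddSubgroup.closure
        (relO (m + 1) A ∪ relM (m + 1) A ∪ relA (m + 1) A) :=
      (QuotientAddGroup.eq_zero_iff y).1 hk
    clear hk
    let f : FreeAbelianGroup (GenTuple (m + 1) A) →+ ℚ ⊗[ℤ] Mn (m + 1) A :=
      (TensorProduct.mk ℤ ℚ (Mn (m + 1) A) 1).toAddMonoidHom.comp (QuotientAddGroup.mk' _)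
    suffices AddSubgroup.closure (relO (m + 1) A ∪ relM (m + 1) A ∪ relA (m + 1) A) ≤
        (LinearMap.range (glue A m)).toAddSubgroup.comap f from this hy
    rw [AddSubgroup.closure_le]
    rintro x (hx | ⟨hn, β, β', h, rfl⟩)
    · have hx₀ : (QuotientAddGroup.mk x : Mn (m + 1) A) = 0 :=
        (QuotientAddGroup.eq_zero_iff x).2 (AddSubgroup.subset_closure hx)
      have hfx : f x = 0 :=
        (congrArg (TensorProduct.mk ℤ ℚ (Mn (m + 1) A) 1) hx₀).trans (map_zero _)
      change f x ∈ LinearMap.range (glue A m)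
      rw [hfx]
      exact zero_mem _
    · exact one_tmul_symb_add_symb_mem_range_glue hm β β' h

theorem range_glue (hm : 1 ≤ m) :
    LinearMap.range (glue A m) = LinearMap.range (kernelInclusion A (m + 1)) := by
  apply le_antisymm
  · rintro _ ⟨x, rfl⟩
    induction x using DirectSum.induction_on with
    | zero => simp
    | of B x =>
      have h : glue A m (DirectSum.lof ℚ _ (fun B => Summand m B) B x) = glueSummand m B x :=
        DirectSum.toModule_lof ..
      exact h ▸ glueSummand_mem_range_kernelInclusion B x
    | add x y hx hy => rw [map_add]; exact add_mem hx hy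
  · rintro _ ⟨x, rfl⟩
    induction x using TensorProduct.induction_on with
    | zero => simp
    | add x y hx hy => rw [map_add]; exact add_mem hx hy
    | tmul q k =>
      have h : kernelInclusion A (m + 1) (q ⊗ₜ[ℤ] k) = q • (1 : ℚ) ⊗ₜ[ℤ] (k : Mn (m + 1) A) := by
        rw [kernelInclusion_tmul, TensorProduct.smul_tmul', smul_eq_mul, mul_one]
      rw [h]
      exact Submodule.smul_mem _ _ (one_tmul_mem_range_glue hm k.2)

/-- The isomorphism `ψ`. -/
noncomputable def glueEquiv (hm : 1 ≤ m) :
    DirectSum (CocyclicSubgroup A) (fun B => Summand m B) ≃ₗ[ℚ] ℚ ⊗[ℤ] Kn (m + 1) A :=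
  (LinearEquiv.ofInjective (glue A m) glue_injective).trans
    ((LinearEquiv.ofEq _ _ (range_glue hm)).trans
      (LinearEquiv.ofInjective (kernelInclusion A (m + 1)) (kernelInclusion_injective _)).symm)

theorem kernelInclusion_glueEquiv (hm : 1 ≤ m)
    (x : DirectSum (CocyclicSubgroup A) (fun B => Summand m B)) :
    kernelInclusion A (m + 1) (glueEquiv hm x) = glue A m x := by
  set y := LinearEquiv.ofEq _ _ (range_glue hm)
    (LinearEquiv.ofInjective (glue A m) glue_injective x)
  exact congrArg Subtype.val ((LinearEquiv.ofInjective (kernelInclusion A (m + 1))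
    (kernelInclusion_injective _)).apply_symm_apply y)

end Range

end KPT

attribute [local instance] Classical.propDecidable

open KPT TensorProduct in
theorem statement_16 (A : Type) [AddCommGroup A] [Finite A] (m : ℕ) (hm : 1 ≤ m) :
    -- the direct sum is over nonzero subgroups `B ⊆ A` with `A/B` cyclic
    ∃ ψ : DirectSum {B : AddSubgroup A // B ≠ ⊥ ∧ IsAddCyclic (A ⧸ B)}
        (fun B => ℚ ⊗[ℤ] (M1Plus (A ⧸ B.1) ⊗[ℤ] MnMinus m B.1))
        ≃ₗ[ℚ] ℚ ⊗[ℤ] (Kn (m+1) A),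
      ∀ (B : {B : AddSubgroup A // B ≠ ⊥ ∧ IsAddCyclic (A ⧸ B)})
        (α : GenTuple 1 (A ⧸ B.1)) (b : GenTuple m B.1) (aLift : A)
        (hlift : QuotientAddGroup.mk aLift = α.1 0)
        (h₁ : AddSubgroup.closure (Set.range
          (Fin.cons aLift (fun i => ((b.1 i : B.1) : A)) : Fin (m+1) → A)) = ⊤)
        (h₂ : AddSubgroup.closure (Set.range
          (Fin.cons (-aLift) (fun i => ((b.1 i : B.1) : A)) : Fin (m+1) → A)) = ⊤),
        LinearMap.lTensor ℚ ((Kn (m+1) A).subtype.toIntLinearMap)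
          (ψ (DirectSum.lof ℚ _
            (fun B => ℚ ⊗[ℤ] (M1Plus (A ⧸ B.1) ⊗[ℤ] MnMinus m B.1)) B
            ((1 : ℚ) ⊗ₜ[ℤ] (symbP (A ⧸ B.1) α ⊗ₜ[ℤ] symbm m B.1 b))))
        = ((1 : ℚ)/2) ⊗ₜ[ℤ]
            (symb (m+1) A ⟨Fin.cons aLift (fun i => ((b.1 i : B.1) : A)), h₁⟩
              + symb (m+1) A ⟨Fin.cons (-aLift) (fun i => ((b.1 i : B.1) : A)), h₂⟩) := by
  refine ⟨glueEquiv hm, fun B α b a ha h₁ h₂ => ?_⟩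
  have h := kernelInclusion_glueEquiv hm (DirectSum.lof ℚ _ (fun B => Summand m B) B
    ((1 : ℚ) ⊗ₜ[ℤ] (symbP (A ⧸ B.1) α ⊗ₜ[ℤ] symbm m B.1 b)))
  rw [glue, DirectSum.toModule_lof, glueSummand_symb B α b ha, symmSymb,
    extSymb_of_closure_eq_top h₁, extSymb_of_closure_eq_top h₂] at h
  exact h
end

section
/- Let N ≥ 5 be an integer and A = ℤ/N. If N is even, then the ℚ-vector space M₂⁻(A) ⊗ ℚ has dimension 1 − (φ(N) + φ(N/2))/2 + (N·φ(N)/24)·∏_{p | N}(1 + 1/p), and the torsion subgroup of M₂⁻(A) is isomorphic to (ℤ/2)^{φ(N) + φ(N/2) − 1}. If N is odd, then M₂⁻(A) ⊗ ℚ has dimension 1 − φ(N)/2 + (N·φ(N)/24)·∏_{p | N}(1 + 1/p), and the torsion subgroup of M₂⁻(A) is isomorphic to (ℤ/2)^{φ(N) − 1}. Here φ is Euler's totient function and the products run over the distinct primes p dividing N. -/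
open FreeAbelianGroup AddSubgroup

namespace KPT

section Symbols

variable {N : ℕ}

lemma closure_range_eq_top_iff (b : Fin 2 → ZMod N) :
    AddSubgroup.closure (Set.range b) = ⊤ ↔ IsCoprime (b 0) (b 1) := by
  have hr : Set.range b = {b 0, b 1} := by
    ext x; simp [Fin.exists_fin_two, eq_comm]
  rw [hr]
  constructor
  · intro h
    have h1 : (1 : ZMod N) ∈ AddSubgroup.closure {b 0, b 1} := by rw [h]; trivial
    obtain ⟨m, n, hmn⟩ := AddSubgroup.mem_closure_pair.1 h1
    exact ⟨m, n, by simpa using hmn⟩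
  · rintro ⟨x, y, hxy⟩
    rw [eq_top_iff]
    intro z _
    obtain ⟨m, hm⟩ := ZMod.intCast_surjective (z * x)
    obtain ⟨n, hn⟩ := ZMod.intCast_surjective (z * y)
    refine AddSubgroup.mem_closure_pair.2 ⟨m, n, ?_⟩
    rw [zsmul_eq_mul, zsmul_eq_mul, hm, hn]
    linear_combination z * hxy

/-- The pair `(a, b)` as a generating tuple. -/
def pairTuple (a b : ZMod N) (h : IsCoprime a b) : GenTuple 2 (ZMod N) :=
  ⟨![a, b], (closure_range_eq_top_iff _).2 h⟩

open Classical in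
/-- The symbol `⟨a, b⟩⁻`, extended by zero to pairs that do not generate. -/
noncomputable def sym (a b : ZMod N) : MnMinus 2 (ZMod N) :=
  if h : IsCoprime a b then symbm 2 _ (pairTuple a b h) else 0

lemma GenTuple.isCoprime (β : GenTuple 2 (ZMod N)) : IsCoprime (β.1 0) (β.1 1) :=
  (closure_range_eq_top_iff _).1 β.2

lemma symbm_eq_sym (β : GenTuple 2 (ZMod N)) : symbm 2 _ β = sym (β.1 0) (β.1 1) := by
  rw [sym, dif_pos (GenTuple.isCoprime β)]
  congr 1
  apply Subtype.ext
  funext i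
  fin_cases i <;> rfl

lemma mk_eq_zero_of_mem {x : FreeAbelianGroup (GenTuple 2 (ZMod N))}
    (hx : x ∈ relO 2 (ZMod N) ∪ relM 2 (ZMod N) ∪ relA 2 (ZMod N)) :
    (QuotientAddGroup.mk x : MnMinus 2 (ZMod N)) = QuotientAddGroup.mk 0 := by
  rw [QuotientAddGroup.eq]
  simpa using AddSubgroup.subset_closure hx

lemma isCoprime_sub_left_iff (a b : ZMod N) : IsCoprime (a - b) b ↔ IsCoprime a b := by
  have := IsCoprime.add_mul_right_left_iff (x := a) (y := b) (z := -1)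
  rwa [neg_one_mul, ← sub_eq_add_neg] at this

lemma isCoprime_sub_right_iff (a b : ZMod N) : IsCoprime a (b - a) ↔ IsCoprime a b := by
  rw [isCoprime_comm, isCoprime_sub_left_iff, isCoprime_comm]

lemma sym_swap (a b : ZMod N) : sym b a = sym a b := by
  by_cases h : IsCoprime a b
  · rw [sym, sym, dif_pos h, dif_pos h.symm, eq_comm, ← sub_eq_zero]
    refine mk_eq_zero_of_mem (x := of _ - of _) (Or.inl (Or.inl ⟨_, _, Equiv.swap 0 1, ?_, rfl⟩))
    funext i
    fin_cases i <;> rfl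
  · rw [sym, sym, dif_neg h, dif_neg (by rwa [isCoprime_comm])]

lemma sym_neg_left (a b : ZMod N) : sym (-a) b = -sym a b := by
  by_cases h : IsCoprime a b
  · rw [sym, sym, dif_pos h, dif_pos (h.neg_left), eq_neg_iff_add_eq_zero, add_comm]
    refine mk_eq_zero_of_mem (x := of _ + of _) (Or.inr ⟨by norm_num, _, _, ?_, rfl⟩)
    funext i
    fin_cases i <;> rfl
  · rw [sym, sym, dif_neg h, dif_neg (by rwa [IsCoprime.neg_left_iff]), neg_zero]

lemma sym_blowup (a b : ZMod N) : sym a b = sym (a - b) b + sym a (b - a) := by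
  by_cases h : IsCoprime a b
  · rw [sym, sym, sym, dif_pos h, dif_pos ((isCoprime_sub_left_iff _ _).2 h),
      dif_pos ((isCoprime_sub_right_iff _ _).2 h), ← sub_eq_zero, ← sub_sub]
    refine mk_eq_zero_of_mem (x := of _ - of _ - of _)
      (Or.inl (Or.inr ⟨le_rfl, _, _, _, ?_, ?_, rfl⟩)) <;>
    · funext i
      fin_cases i <;> rfl
  · rw [sym, sym, sym, dif_neg h, dif_neg (by rwa [isCoprime_sub_left_iff]),
      dif_neg (by rwa [isCoprime_sub_right_iff]), add_zero]

lemma sym_neg_right (a b : ZMod N) : sym a (-b) = -sym a b := by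
  rw [← sym_swap, sym_neg_left, sym_swap]

lemma sym_triangle (u v : ZMod N) : sym u v + sym v (-u - v) + sym (-u - v) u = 0 := by
  have h := sym_blowup u (-v)
  have h1 : sym (u - -v) (-v) = sym v (-u - v) := by
    rw [show u - -v = -(-u - v) by ring, sym_neg_left, sym_neg_right, neg_neg, sym_swap]
  have h2 : sym u (-v - u) = sym (-u - v) u := by
    rw [show -v - u = -u - v by ring, sym_swap]
  rw [sym_neg_right, h1, h2] at h
  rw [add_assoc, ← h, add_neg_cancel]

lemma exists_lift {B : Type*} [AddCommGroup B] (F : ZMod N → ZMod N → B)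
    (hO : ∀ a b, F b a = F a b) (hA : ∀ a b, F (-a) b = -F a b)
    (hT : ∀ u v, IsCoprime u v → F u v + F v (-u - v) + F (-u - v) u = 0) : ∃ φ : MnMinus 2 (ZMod N) →+ B,
    ∀ a b, IsCoprime a b → φ (sym a b) = F a b := by
  let φ₀ : FreeAbelianGroup (GenTuple 2 (ZMod N)) →+ B :=
    FreeAbelianGroup.lift fun β => F (β.1 0) (β.1 1)
  have h₀ (β : GenTuple 2 (ZMod N)) : φ₀ (of β) = F (β.1 0) (β.1 1) :=
    FreeAbelianGroup.lift_apply_of _ _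
  have hle : AddSubgroup.closure (relO 2 (ZMod N) ∪ relM 2 (ZMod N) ∪ relA 2 (ZMod N))
      ≤ φ₀.ker := by
    rw [AddSubgroup.closure_le]
    rintro x ((⟨β, β', σ, hσ, rfl⟩ | ⟨_, β, β₁, β₂, h1, h2, rfl⟩) | ⟨_, β, β', h, rfl⟩) <;>
      simp only [SetLike.mem_coe, AddMonoidHom.mem_ker, map_sub, map_add, h₀]
    · rw [hσ, Function.comp, sub_eq_zero]
      have hne : σ 0 ≠ σ 1 := σ.injective.ne (by decide)
      rcases Fin.exists_fin_two.1 ⟨σ 0, rfl⟩ with h0 | h0 <;>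
        rcases Fin.exists_fin_two.1 ⟨σ 1, rfl⟩ with h1 | h1 <;> simp_all
    · have e1 : β₁.1 0 = β.1 0 - β.1 1 := by rw [h1]; rfl
      have e2 : β₁.1 1 = β.1 1 := by rw [h1]; rfl
      have e3 : β₂.1 0 = β.1 0 := by rw [h2]; rfl
      have e4 : β₂.1 1 = β.1 1 - β.1 0 := by rw [h2]; rfl
      rw [e1, e2, e3, e4]
      have hA' (a b) : F a (-b) = -F a b := by rw [← hO, hA, hO]
      have := hT (β.1 0) (-β.1 1) (GenTuple.isCoprime β).neg_right
      rw [hA', show -β.1 0 - -β.1 1 = -(β.1 0 - β.1 1) by ring, hA, hA', neg_neg, hO (β.1 0 - β.1 1),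
        show -(β.1 0 - β.1 1) = β.1 1 - β.1 0 by ring, hO (β.1 0) (β.1 1 - β.1 0)] at this
      rw [sub_sub, ← neg_eq_zero, ← this]
      abel
    · have e1 : β'.1 0 = -β.1 0 := by rw [h]; rfl
      have e2 : β'.1 1 = β.1 1 := by rw [h]; rfl
      rw [e1, e2, hA, add_neg_cancel]
  refine ⟨QuotientAddGroup.lift _ φ₀ hle, fun a b h => ?_⟩
  rw [sym, dif_pos h]
  exact h₀ _

lemma closure_sym : AddSubgroup.closure
    {x : MnMinus 2 (ZMod N) | ∃ a b, IsCoprime a b ∧ x = sym a b} = ⊤ := by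
  rw [eq_top_iff]
  rintro x -
  obtain ⟨y, rfl⟩ := QuotientAddGroup.mk_surjective x
  induction y using FreeAbelianGroup.induction_on with
  | zero => exact zero_mem _
  | of β => exact AddSubgroup.subset_closure ⟨_, _, GenTuple.isCoprime β, symbm_eq_sym β⟩
  | neg β h => exact neg_mem h
  | add x y hx hy => exact add_mem hx hy

end Symbols
end KPT

namespace KPT

section GraphCohomology

open Module TensorProduct

lemma finrank_rat_tensor (G : Type) [AddCommGroup G] : finrank ℚ (ℚ ⊗[ℤ] G) = finrank ℤ G :=
  IsBaseChange.finrank_eq (TensorProduct.isBaseChange ℤ G ℚ)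

variable {E H V : Type} (s t : E → V) (b : H → Option V)

/-- The coboundary of a finite graph with edges `E` from `s` to `t` and half-edges `H` attached
to vertices by `b` (or floating), where the half-edges carry coefficients modulo two. -/
def coboundary : (V → ℤ) →ₗ[ℤ] (E → ℤ) × (H → ZMod 2) where
  toFun f := (fun e => f (s e) - f (t e), fun h => (b h).elim 0 fun v => (f v : ZMod 2))
  map_add' f g := by
    ext x
    · simp only [Pi.add_apply, Prod.mk_add_mk]; ring
    · simp only [Pi.add_apply, Prod.mk_add_mk]
      cases b x <;> simp
  map_smul' n f := by
    ext x
    · simp only [Pi.smul_apply, Prod.smul_mk, smul_eq_mul, RingHom.id_apply]; ring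
    · simp only [Pi.smul_apply, Prod.smul_mk, RingHom.id_apply]
      cases b x <;> simp

variable {s t b} {G : Type} [AddCommGroup G] {π : (E → ℤ) × (H → ZMod 2) →ₗ[ℤ] G}

lemma two_nsmul_inr (y : H → ZMod 2) : (2 : ℕ) • ((0, y) : (E → ℤ) × (H → ZMod 2)) = 0 := by
  ext h
  · simp
  · simp [CharTwo.two_eq_zero]

/-- The contribution of the half-edges to the torsion of the cokernel. -/
def halfEdgeTorsion (π : (E → ℤ) × (H → ZMod 2) →ₗ[ℤ] G) :
    (H → ZMod 2) →+ AddCommGroup.torsion G :=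
  (π.toAddMonoidHom.comp (AddMonoidHom.inr (E → ℤ) (H → ZMod 2))).codRestrict _ fun y =>
    isOfFinAddOrder_iff_nsmul_eq_zero.2 ⟨2, two_pos, by
      change 2 • π (0, y) = 0
      rw [← map_nsmul, two_nsmul_inr, map_zero]⟩

lemma mem_ker_halfEdgeTorsion (hker : LinearMap.ker π = LinearMap.range (coboundary s t b))
    (y : H → ZMod 2) :
    y ∈ (halfEdgeTorsion π).ker ↔ ∃ f, coboundary s t b f = (0, y) := by
  rw [← LinearMap.mem_range, ← hker, LinearMap.mem_ker, AddMonoidHom.mem_ker, Subtype.ext_iff]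
  rfl

/-- A graph is connected if locally constant functions on its vertices are constant. -/
def IsConnectedGraph (s t : E → V) : Prop :=
  ∀ (B : Type) (f : V → B), (∀ e, f (s e) = f (t e)) → ∀ v w, f v = f w

lemma halfEdgeTorsion_surjective (hcon : IsConnectedGraph s t)
    (hker : LinearMap.ker π = LinearMap.range (coboundary s t b))
    (hsurj : Function.Surjective π) : Function.Surjective (halfEdgeTorsion π) := by
  rintro ⟨g, hg⟩
  obtain ⟨⟨x, y⟩, rfl⟩ := hsurj g
  obtain ⟨n, hn, hng⟩ := isOfFinAddOrder_iff_nsmul_eq_zero.1 hg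
  rw [← map_nsmul, ← LinearMap.mem_ker, hker] at hng
  obtain ⟨f, hf⟩ := hng
  have hf1 (e : E) : f (s e) - f (t e) = n * x e := by
    have := congr_fun (congr_arg Prod.fst hf) e
    simpa [coboundary] using this
  have hmod := hcon (ZMod n) (fun v => (f v : ZMod n)) fun e => by
    rw [← sub_eq_zero, ← Int.cast_sub, hf1]
    simp
  have hdvd (v w : V) : (n : ℤ) ∣ f v - f w := by
    rw [← ZMod.intCast_zmod_eq_zero_iff_dvd, Int.cast_sub, sub_eq_zero]
    exact hmod v w
  obtain ⟨c, k, hk⟩ : ∃ (c : ℤ) (k : V → ℤ), ∀ v, f v = c + n * k v := by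
    rcases isEmpty_or_nonempty V with h | ⟨⟨v₀⟩⟩
    · exact ⟨0, 0, fun v => (h.false v).elim⟩
    · choose k hk using fun v => hdvd v v₀
      exact ⟨f v₀, k, fun v => by linarith [hk v]⟩
  have hx : x = (coboundary s t b k).1 := by
    funext e
    have := hf1 e
    rw [hk, hk] at this
    have hn' : (n : ℤ) ≠ 0 := by exact_mod_cast hn.ne'
    apply mul_left_cancel₀ hn'
    rw [← this]
    simp only [coboundary, LinearMap.coe_mk, AddHom.coe_mk]
    ring
  refine ⟨y - (coboundary s t b k).2, Subtype.ext ?_⟩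
  change π (0, _) = π (x, y)
  have h0 : π (coboundary s t b k) = 0 := by
    rw [← LinearMap.mem_ker, hker]; exact ⟨k, rfl⟩
  rw [← sub_zero (π (x, y)), ← h0, ← map_sub]
  congr 1
  ext <;> simp [hx]

lemma nonempty_addEquiv_of_ker_eq {A B C : Type} [AddCommGroup A] [AddCommGroup B]
    [AddCommGroup C] (f : A →+ B) (g : A →+ C) (hf : Function.Surjective f)
    (hg : Function.Surjective g) (h : f.ker = g.ker) : Nonempty (B ≃+ C) :=
  ⟨(QuotientAddGroup.quotientKerEquivOfSurjective f hf).symm.trans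
    ((QuotientAddGroup.quotientAddEquivOfEq h).trans
      (QuotientAddGroup.quotientKerEquivOfSurjective g hg))⟩

lemma finrank_int_prod_zmod_two (E H : Type) [Fintype E] [Fintype H] :
    finrank ℤ ((E → ℤ) × (H → ZMod 2)) = Fintype.card E := by
  have h := (LinearMap.ker (LinearMap.fst ℤ (E → ℤ) (H → ZMod 2))).finrank_quotient_add_finrank
  rw [(LinearMap.quotKerEquivOfSurjective _ LinearMap.fst_surjective).finrank_eq,
    finrank_fintype_fun_eq_card] at h
  have h0 : finrank ℤ (LinearMap.ker (LinearMap.fst ℤ (E → ℤ) (H → ZMod 2))) = 0 := by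
    apply Module.IsTorsion.finrank_eq_zero
    rintro ⟨⟨x, y⟩, hxy⟩
    obtain rfl : x = 0 := hxy
    refine ⟨⟨2, by simp⟩, Subtype.ext ?_⟩
    exact (ofNat_zsmul _ 2).trans (two_nsmul_inr y)
  rw [h0, add_zero] at h
  exact h.symm

lemma finrank_add_card_vertices [Fintype E] [Fintype H] [Fintype V]
    (hker : LinearMap.ker π = LinearMap.range (coboundary s t b))
    (hsurj : Function.Surjective π) :
    finrank ℤ G + Fintype.card V
      = Fintype.card E + finrank ℤ (LinearMap.ker (coboundary s t b)) := by
  have h1 := (LinearMap.ker π).finrank_quotient_add_finrank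
  rw [(π.quotKerEquivOfSurjective hsurj).finrank_eq, hker] at h1
  have h2 := (LinearMap.ker (coboundary s t b)).finrank_quotient_add_finrank
  rw [(coboundary s t b).quotKerEquivRange.finrank_eq, finrank_fintype_fun_eq_card] at h2
  have h3 := finrank_int_prod_zmod_two E H
  omega

lemma ker_coboundary (hb : ∃ h v, b h = some v) (hcon : IsConnectedGraph s t) :
    LinearMap.ker (coboundary s t b) = Submodule.span ℤ {fun _ => 2} := by
  obtain ⟨h₀, v₀, hv⟩ := hb
  ext f
  rw [LinearMap.mem_ker, Submodule.mem_span_singleton]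
  constructor
  · intro hf
    have hc := hcon ℤ f fun e => by
      have := congr_fun (congr_arg Prod.fst hf) e
      simpa [coboundary, sub_eq_zero] using this
    have h2 : (f v₀ : ZMod 2) = 0 := by
      have := congr_fun (congr_arg Prod.snd hf) h₀
      simpa [coboundary, hv] using this
    obtain ⟨k, hk⟩ := (ZMod.intCast_zmod_eq_zero_iff_dvd _ 2).1 h2
    refine ⟨k, ?_⟩
    funext v
    rw [hc v v₀, hk]
    simp [mul_comm]
  · rintro ⟨k, rfl⟩
    ext h
    · simp [coboundary]
    · simp only [coboundary, LinearMap.coe_mk, AddHom.coe_mk]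
      cases b h <;> simp [CharTwo.two_eq_zero]

/-- The rank of the cohomology of a connected graph with half-edges. -/
lemma finrank_of_connected [Fintype E] [Fintype H] [Fintype V] [Nonempty V]
    (hb : ∃ h v, b h = some v) (hcon : IsConnectedGraph s t)
    (hker : LinearMap.ker π = LinearMap.range (coboundary s t b))
    (hsurj : Function.Surjective π) :
    finrank ℤ G + Fintype.card V = Fintype.card E + 1 := by
  rw [finrank_add_card_vertices hker hsurj, ker_coboundary hb hcon]
  obtain ⟨v₀⟩ := ‹Nonempty V›
  have hne : (fun _ : V => (2 : ℤ)) ≠ 0 := fun h => by simpa using congr_fun h v₀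
  rw [← (LinearEquiv.toSpanNonzeroSingleton ℤ _ _ hne).finrank_eq, finrank_self]

/-- The torsion of the cohomology of a connected graph with half-edges. -/
lemma torsion_of_connected [Fintype H] [Nonempty V]
    (hb : ∃ h v, b h = some v) (hcon : IsConnectedGraph s t)
    (hker : LinearMap.ker π = LinearMap.range (coboundary s t b))
    (hsurj : Function.Surjective π) :
    Nonempty (AddCommGroup.torsion G ≃+ (Fin (Fintype.card H - 1) → ZMod 2)) := by
  obtain ⟨h₀, v₀, hv⟩ := hb
  let y₀ : H → ZMod 2 := fun h => (b h).elim 0 fun _ => 1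
  have hy₀ : y₀ ≠ 0 := fun h => by simpa [y₀, hv] using congr_fun h h₀
  let K : Submodule (ZMod 2) (H → ZMod 2) := Submodule.span _ {y₀}
  have hK := K.finrank_quotient_add_finrank
  rw [finrank_span_singleton hy₀, finrank_fintype_fun_eq_card] at hK
  let L : ((H → ZMod 2) ⧸ K) ≃ₗ[ZMod 2] (Fin (Fintype.card H - 1) → ZMod 2) :=
    LinearEquiv.ofFinrankEq _ _ (by rw [finrank_fintype_fun_eq_card, Fintype.card_fin]; omega)
  refine nonempty_addEquiv_of_ker_eq (halfEdgeTorsion π)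
    (L.toLinearMap ∘ₗ K.mkQ).toAddMonoidHom (halfEdgeTorsion_surjective hcon hker hsurj)
    (L.surjective.comp K.mkQ_surjective) ?_
  ext y
  rw [mem_ker_halfEdgeTorsion hker]
  have : y ∈ (L.toLinearMap ∘ₗ K.mkQ).toAddMonoidHom.ker ↔ y ∈ K := by
    rw [AddMonoidHom.mem_ker]
    change L (K.mkQ y) = 0 ↔ _
    rw [L.map_eq_zero_iff, K.mkQ_apply, Submodule.Quotient.mk_eq_zero]
  rw [this, Submodule.mem_span_singleton]
  constructor
  · rintro ⟨f, hf⟩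
    have hc := hcon ℤ f fun e => by
      have := congr_fun (congr_arg Prod.fst hf) e
      simpa [coboundary, sub_eq_zero] using this
    refine ⟨(f v₀ : ZMod 2), ?_⟩
    rw [← show _ = y from congr_arg Prod.snd hf]
    funext h
    simp only [coboundary, LinearMap.coe_mk, AddHom.coe_mk, Pi.smul_apply, y₀]
    cases b h with
    | none => simp
    | some v => simp [hc v v₀]
  · rintro ⟨c, rfl⟩
    refine ⟨fun _ => c.val, ?_⟩
    ext h
    · simp [coboundary]
    · simp only [coboundary, LinearMap.coe_mk, AddHom.coe_mk, Pi.smul_apply, y₀]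
      cases b h <;> simp

/-- The torsion in the absence of vertices. -/
lemma torsion_of_isEmpty [Fintype H] [IsEmpty V] [IsEmpty E]
    (hker : LinearMap.ker π = LinearMap.range (coboundary s t b))
    (hsurj : Function.Surjective π) :
    Nonempty (AddCommGroup.torsion G ≃+ (Fin (Fintype.card H) → ZMod 2)) := by
  let L : (H → ZMod 2) ≃ₗ[ZMod 2] (Fin (Fintype.card H) → ZMod 2) :=
    LinearEquiv.ofFinrankEq _ _ (by simp)
  refine nonempty_addEquiv_of_ker_eq (halfEdgeTorsion π) L.toLinearMap.toAddMonoidHom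
    (halfEdgeTorsion_surjective (fun _ _ _ v => isEmptyElim v) hker hsurj) L.surjective ?_
  ext y
  rw [mem_ker_halfEdgeTorsion hker]
  have : y ∈ L.toLinearMap.toAddMonoidHom.ker ↔ y = 0 := by
    rw [AddMonoidHom.mem_ker]
    exact L.map_eq_zero_iff
  rw [this]
  constructor
  · rintro ⟨f, hf⟩
    rw [Subsingleton.elim f 0, map_zero] at hf
    exact (congr_arg Prod.snd hf).symm
  · rintro rfl
    exact ⟨0, map_zero _⟩

/-- The rank in the absence of vertices and edges. -/
lemma finrank_of_isEmpty [Fintype H] [IsEmpty V] [IsEmpty E]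
    (hker : LinearMap.ker π = LinearMap.range (coboundary s t b))
    (hsurj : Function.Surjective π) : finrank ℤ G = 0 := by
  let _ : Fintype V := Fintype.ofIsEmpty
  let _ : Fintype E := Fintype.ofIsEmpty
  have := finrank_add_card_vertices hker hsurj
  have h0 : finrank ℤ (LinearMap.ker (coboundary s t b)) = 0 := finrank_zero_of_subsingleton
  simpa [h0] using this

end GraphCohomology
end KPT

namespace KPT

section Relations

variable {N : ℕ}

/-- Reflection of a pair in the first coordinate. -/
def bar (z : ZMod N × ZMod N) : ZMod N × ZMod N := (-z.1, z.2)

/-- Rotation of the triple `(a, b, -a - b)`. -/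
def rot (z : ZMod N × ZMod N) : ZMod N × ZMod N := (z.2, -z.1 - z.2)

/-- Pairs agreeing up to order and a common sign. -/
def DartRel (z y : ZMod N × ZMod N) : Prop :=
  (y.1 = z.1 ∧ y.2 = z.2) ∨ (y.1 = z.2 ∧ y.2 = z.1) ∨ (y.1 = -z.1 ∧ y.2 = -z.2) ∨
    (y.1 = -z.2 ∧ y.2 = -z.1)

/-- Pairs agreeing up to order and signs. -/
def EdgeRel (z y : ZMod N × ZMod N) : Prop := DartRel z y ∨ DartRel (bar z) y

/-- Pairs whose zero-sum triples agree up to order and a common sign. -/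
def VertexRel (z y : ZMod N × ZMod N) : Prop :=
  DartRel z y ∨ DartRel (rot z) y ∨ DartRel (rot (rot z)) y

lemma DartRel.refl (z : ZMod N × ZMod N) : DartRel z z := by grind [DartRel]

lemma DartRel.symm {z y : ZMod N × ZMod N} (h : DartRel z y) : DartRel y z := by
  grind [DartRel]

lemma DartRel.trans {x y z : ZMod N × ZMod N} (h : DartRel x y) (h' : DartRel y z) :
    DartRel x z := by
  grind [DartRel]

lemma bar_bar (z : ZMod N × ZMod N) : bar (bar z) = z := by grind [bar]

lemma DartRel.bar {z y : ZMod N × ZMod N} (h : DartRel z y) : DartRel (bar z) (bar y) := by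
  grind [DartRel, KPT.bar]

lemma dartRel_bar_right {z y : ZMod N × ZMod N} :
    DartRel z (bar y) ↔ DartRel (bar z) y :=
  ⟨fun h => by simpa only [bar_bar] using h.bar, fun h => by simpa only [bar_bar] using h.bar⟩

lemma EdgeRel.symm {z y : ZMod N × ZMod N} (h : EdgeRel z y) : EdgeRel y z :=
  h.imp DartRel.symm fun h => (dartRel_bar_right.2 h).symm

lemma EdgeRel.trans {x y z : ZMod N × ZMod N} (h : EdgeRel x y) (h' : EdgeRel y z) :
    EdgeRel x z := by
  rcases h with h | h <;> rcases h' with h' | h'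
  · exact Or.inl (h.trans h')
  · exact Or.inr (h.bar.trans h')
  · exact Or.inr (h.trans h')
  · exact Or.inl (by simpa only [bar_bar] using h.bar.trans h')

lemma rot_rot (z : ZMod N × ZMod N) : rot (rot z) = (-z.1 - z.2, z.1) := by grind [rot]

lemma rot_rot_rot (z : ZMod N × ZMod N) : rot (rot (rot z)) = z := by grind [rot]

lemma VertexRel.rot_left {z y : ZMod N × ZMod N} (h : VertexRel z y) : VertexRel (rot z) y := by
  unfold VertexRel at h ⊢
  rw [rot_rot_rot]
  tauto

lemma DartRel.vertexRel_rot {z y : ZMod N × ZMod N} (h : DartRel z y) : VertexRel z (rot y) := by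
  rcases h with h | h | h | h
  · exact Or.inr (Or.inl (by grind [DartRel, rot]))
  · exact Or.inr (Or.inr (by grind [DartRel, rot]))
  · exact Or.inr (Or.inl (by grind [DartRel, rot]))
  · exact Or.inr (Or.inr (by grind [DartRel, rot]))

lemma VertexRel.rot_right {z y : ZMod N × ZMod N} (h : VertexRel z y) : VertexRel z (rot y) := by
  rcases h with h | h | h
  · exact h.vertexRel_rot
  · simpa only [rot_rot_rot] using h.vertexRel_rot.rot_left.rot_left
  · simpa only [rot_rot_rot] using h.vertexRel_rot.rot_left

lemma VertexRel.symm {z y : ZMod N × ZMod N} (h : VertexRel z y) : VertexRel y z := by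
  rcases h with h | h | h
  · exact Or.inl h.symm
  · have : VertexRel y (rot z) := Or.inl h.symm
    simpa only [rot_rot_rot] using this.rot_right.rot_right
  · have : VertexRel y (rot (rot z)) := Or.inl h.symm
    simpa only [rot_rot_rot] using this.rot_right

lemma VertexRel.trans {x y z : ZMod N × ZMod N} (h : VertexRel x y) (h' : VertexRel y z) :
    VertexRel x z := by
  have key {y z : ZMod N × ZMod N} (h : VertexRel x y) (h' : DartRel y z) : VertexRel x z :=
    h.imp (·.trans h') (Or.imp (·.trans h') (·.trans h'))
  rcases h' with h' | h' | h'
  · exact key h h'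
  · exact key h.rot_right h'
  · exact key h.rot_right.rot_right h'

/-- The setoid of pairs up to order and signs. -/
def edgeSetoid (N : ℕ) : Setoid (ZMod N × ZMod N) :=
  ⟨EdgeRel, fun z => Or.inl (DartRel.refl z), EdgeRel.symm, EdgeRel.trans⟩

/-- The setoid of pairs up to rotation, order and a common sign. -/
def vertexSetoid (N : ℕ) : Setoid (ZMod N × ZMod N) :=
  ⟨VertexRel, fun z => Or.inl (DartRel.refl z), VertexRel.symm, VertexRel.trans⟩

/-- Generating pairs with an entry of order at most two, or with one entry twice the other
up to sign. -/
def IsHalf (z : ZMod N × ZMod N) : Prop :=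
  IsCoprime z.1 z.2 ∧ ((2 * z.1 = 0 ∨ 2 * z.2 = 0) ∨
    (z.2 = 2 * z.1 ∨ z.2 = -2 * z.1 ∨ z.1 = 2 * z.2 ∨ z.1 = -2 * z.2))

/-- Generating pairs with entries equal up to sign. -/
def IsDiag (z : ZMod N × ZMod N) : Prop := IsCoprime z.1 z.2 ∧ (z.1 = z.2 ∨ z.1 = -z.2)

/-- Generating pairs with trivial stabilizer under order and signs, and not half. -/
def IsFull (z : ZMod N × ZMod N) : Prop := IsCoprime z.1 z.2 ∧ ¬ IsHalf z ∧ ¬ IsDiag z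

/-- Generating pairs whose triple has nonzero and distinct entries. -/
def IsFree (z : ZMod N × ZMod N) : Prop :=
  IsCoprime z.1 z.2 ∧ z.1 ≠ 0 ∧ z.2 ≠ 0 ∧ z.1 + z.2 ≠ 0 ∧ z.1 ≠ z.2 ∧ 2 * z.1 + z.2 ≠ 0 ∧
    z.1 + 2 * z.2 ≠ 0

lemma DartRel.isCoprime {z y : ZMod N × ZMod N} (h : DartRel z y) (hz : IsCoprime z.1 z.2) :
    IsCoprime y.1 y.2 := by
  rcases h with ⟨h1, h2⟩ | ⟨h1, h2⟩ | ⟨h1, h2⟩ | ⟨h1, h2⟩ <;> rw [h1, h2]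
  · exact hz
  · exact hz.symm
  · exact hz.neg_neg
  · exact hz.symm.neg_neg

lemma isCoprime_bar {z : ZMod N × ZMod N} (h : IsCoprime z.1 z.2) :
    IsCoprime (bar z).1 (bar z).2 := h.neg_left

lemma isCoprime_rot {z : ZMod N × ZMod N} (h : IsCoprime z.1 z.2) :
    IsCoprime (rot z).1 (rot z).2 := by
  obtain ⟨a, b, h⟩ := h
  exact ⟨b - a, -a, by simp only [rot]; linear_combination h⟩

lemma EdgeRel.isCoprime {z y : ZMod N × ZMod N} (h : EdgeRel z y) (hz : IsCoprime z.1 z.2) :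
    IsCoprime y.1 y.2 :=
  h.elim (·.isCoprime hz) (·.isCoprime (isCoprime_bar hz))

lemma EdgeRel.isHalf {z y : ZMod N × ZMod N} (h : EdgeRel z y) (hz : IsHalf z) : IsHalf y := by
  refine ⟨h.isCoprime hz.1, ?_⟩
  have := hz.2
  clear hz
  rcases h with h | h
  · rcases h with h | h | h | h <;> grind
  · rcases h with h | h | h | h <;> grind [bar]

lemma EdgeRel.isDiag {z y : ZMod N × ZMod N} (h : EdgeRel z y) (hz : IsDiag z) : IsDiag y := by
  refine ⟨h.isCoprime hz.1, ?_⟩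
  have := hz.2
  clear hz
  rcases h with h | h
  · rcases h with h | h | h | h <;> grind
  · rcases h with h | h | h | h <;> grind [bar]

lemma EdgeRel.isFull {z y : ZMod N × ZMod N} (h : EdgeRel z y) (hz : IsFull z) : IsFull y :=
  ⟨h.isCoprime hz.1, fun hy => hz.2.1 (h.symm.isHalf hy), fun hy => hz.2.2 (h.symm.isDiag hy)⟩

lemma edgeRel_bar (z : ZMod N × ZMod N) : EdgeRel z (bar z) := Or.inr (DartRel.refl _)

lemma IsFree.rot {z : ZMod N × ZMod N} (h : IsFree z) : IsFree (rot z) := by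
  refine ⟨isCoprime_rot h.1, ?_⟩
  have := h.2
  clear h
  simp only [KPT.rot]
  grind

lemma DartRel.isFree {z y : ZMod N × ZMod N} (h : DartRel z y) (hz : IsFree z) : IsFree y := by
  refine ⟨h.isCoprime hz.1, ?_⟩
  have := hz.2
  clear hz
  rcases h with h | h | h | h <;> grind

lemma VertexRel.isFree {z y : ZMod N × ZMod N} (h : VertexRel z y) (hz : IsFree z) : IsFree y := by
  rcases h with h | h | h
  · exact h.isFree hz
  · exact h.isFree hz.rot
  · exact h.isFree hz.rot.rot

lemma IsFull.isFree {z : ZMod N × ZMod N} (h : IsFull z) : IsFree z := by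
  obtain ⟨h1, h2, h3⟩ := h
  refine ⟨h1, ?_⟩
  simp only [IsHalf, IsDiag, h1, true_and] at h2 h3
  clear h1
  grind

lemma IsFull.bar {z : ZMod N × ZMod N} (h : IsFull z) : IsFull (bar z) := (edgeRel_bar z).isFull h

lemma IsFull.not_dartRel_bar {z : ZMod N × ZMod N} (h : IsFull z) : ¬ DartRel (KPT.bar z) z := by
  obtain ⟨h1, h2, h3⟩ := h
  simp only [IsHalf, IsDiag, h1, true_and] at h2 h3
  clear h1
  simp only [DartRel, KPT.bar]
  grind

lemma IsHalf.dartRel_bar {z : ZMod N × ZMod N} (h : IsHalf z) (h1 : IsFree z)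
    (h2 : IsFree (bar z)) : DartRel z (bar z) := by
  have h := h.2
  have h1 := h1.2
  have h2 := h2.2
  simp only [DartRel, bar] at *
  grind

lemma IsDiag.not_isHalf (hN : 4 ≤ N) {z : ZMod N × ZMod N} (h : IsDiag z) : ¬ IsHalf z := by
  rintro ⟨-, h'⟩
  obtain ⟨h, hd⟩ := h
  have h6 : (2 : ZMod N) = 0 ∨ (1 : ZMod N) = 0 ∨ (3 : ZMod N) = 0 := by
    obtain ⟨u, v, huv⟩ := h
    grind
  have hne {k : ℕ} (hk : 0 < k) (hk' : k < N) : (k : ZMod N) ≠ 0 := fun h =>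
    absurd (Nat.le_of_dvd hk ((ZMod.natCast_eq_zero_iff _ _).1 h)) (by omega)
  rcases h6 with h | h | h
  · exact hne (k := 2) (by norm_num) (by omega) (by exact_mod_cast h)
  · exact hne (k := 1) (by norm_num) (by omega) (by exact_mod_cast h)
  · exact hne (k := 3) (by norm_num) (by omega) (by exact_mod_cast h)

lemma IsFree.not_dartRel_rot {z : ZMod N × ZMod N} (h : IsFree z) : ¬ DartRel (KPT.rot z) z := by
  have h := h.2
  simp only [DartRel, KPT.rot]
  grind

end Relations
end KPT

namespace KPT

section Presentation

open Classical

/-- Edges: classes of full pairs up to order and signs. -/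
abbrev EdgeType (N : ℕ) : Type := {c : Quotient (edgeSetoid N) // IsFull c.out}

/-- Half-edges: classes of half pairs up to order and signs. -/
abbrev HalfEdgeType (N : ℕ) : Type := {c : Quotient (edgeSetoid N) // IsHalf c.out}

/-- Vertices: classes of free pairs up to rotation, order and a common sign. -/
abbrev VertexType (N : ℕ) : Type := {c : Quotient (vertexSetoid N) // IsFree c.out}

variable {N : ℕ}

lemma edgeRel_out (z : ZMod N × ZMod N) : EdgeRel (Quotient.mk (edgeSetoid N) z).out z :=
  Quotient.exact (Quotient.out_eq (Quotient.mk (edgeSetoid N) z))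

lemma vertexRel_out (z : ZMod N × ZMod N) : VertexRel (Quotient.mk (vertexSetoid N) z).out z :=
  Quotient.exact (Quotient.out_eq (Quotient.mk (vertexSetoid N) z))

/-- The vertex of a free pair. -/
def vertex (z : ZMod N × ZMod N) (h : IsFree z) : VertexType N :=
  ⟨Quotient.mk _ z, (vertexRel_out z).symm.isFree h⟩

/-- The edge of a full pair. -/
def edge (z : ZMod N × ZMod N) (h : IsFull z) : EdgeType N :=
  ⟨Quotient.mk _ z, (edgeRel_out z).symm.isFull h⟩

/-- The half-edge of a half pair. -/
def halfEdge (z : ZMod N × ZMod N) (h : IsHalf z) : HalfEdgeType N :=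
  ⟨Quotient.mk _ z, (edgeRel_out z).symm.isHalf h⟩

lemma vertex_eq_iff {z y : ZMod N × ZMod N} (hz : IsFree z) (hy : IsFree y) :
    vertex z hz = vertex y hy ↔ VertexRel z y :=
  Subtype.ext_iff.trans ⟨Quotient.exact, fun h => Quotient.sound h⟩

lemma EdgeType.eq_of_edgeRel {e e' : EdgeType N} (h : EdgeRel e.1.out e'.1.out) : e = e' :=
  Subtype.ext (Quotient.out_equiv_out.1 h)

lemma HalfEdgeType.eq_of_edgeRel {e e' : HalfEdgeType N} (h : EdgeRel e.1.out e'.1.out) : e = e' :=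
  Subtype.ext (Quotient.out_equiv_out.1 h)

/-- The source of an edge. -/
noncomputable def edgeSource (e : EdgeType N) : VertexType N := vertex e.1.out e.2.isFree

/-- The target of an edge. -/
noncomputable def edgeTarget (e : EdgeType N) : VertexType N := vertex (bar e.1.out) e.2.bar.isFree

/-- The vertex of a half-edge, if any. -/
noncomputable def halfEdgeVertex (c : HalfEdgeType N) : Option (VertexType N) :=
  if h : IsFree c.1.out then some (vertex _ h) else
    if h : IsFree (bar c.1.out) then some (vertex _ h) else none

/-- The universal function satisfying the order and antisymmetry relations. -/
noncomputable def dartCochain (y : ZMod N × ZMod N) :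
    (EdgeType N → ℤ) × (HalfEdgeType N → ZMod 2) :=
  (fun e => (if DartRel e.1.out y then 1 else 0) - (if DartRel (bar e.1.out) y then 1 else 0),
    fun c => if EdgeRel c.1.out y then 1 else 0)

lemma dartRel_congr_right {x y z : ZMod N × ZMod N} (h : DartRel y z) :
    DartRel x y ↔ DartRel x z := ⟨(·.trans h), (·.trans h.symm)⟩

lemma edgeRel_congr_right {x y z : ZMod N × ZMod N} (h : EdgeRel y z) :
    EdgeRel x y ↔ EdgeRel x z := ⟨(·.trans h), (·.trans h.symm)⟩

lemma dartCochain_of_dartRel {y z : ZMod N × ZMod N} (h : DartRel z y) :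
    dartCochain y = dartCochain z := by
  simp only [dartCochain, edgeRel_congr_right (Or.inl h), dartRel_congr_right h]

lemma dartCochain_bar (y : ZMod N × ZMod N) : dartCochain (bar y) = -dartCochain y := by
  ext c
  · simp only [dartCochain, dartRel_bar_right, bar_bar, Prod.fst_neg, Pi.neg_apply, neg_sub]
  · simp only [dartCochain, ← edgeRel_congr_right (edgeRel_bar y), Prod.snd_neg, Pi.neg_apply,
      ZMod.neg_eq_self_mod_two]

lemma dartCochain_out_edge (e : EdgeType N) : dartCochain e.1.out = (Pi.single e 1, 0) := by
  ext c
  · simp only [dartCochain]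
    rcases eq_or_ne c e with rfl | hne
    · rw [if_pos (DartRel.refl _), if_neg c.2.not_dartRel_bar, Pi.single_eq_same, sub_zero]
    · rw [Pi.single_eq_of_ne hne, if_neg fun h => hne (EdgeType.eq_of_edgeRel (Or.inl h)),
        if_neg fun h => hne (EdgeType.eq_of_edgeRel (Or.inr h)), sub_zero]
  · exact if_neg fun h => e.2.2.1 (h.isHalf c.2)

lemma dartCochain_out_halfEdge (c : HalfEdgeType N) :
    dartCochain c.1.out = (0, Pi.single c 1) := by
  ext d
  · simp only [dartCochain]
    rw [if_neg fun h => (EdgeRel.isFull (Or.inl h) d.2).2.1 c.2,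
      if_neg fun h => (EdgeRel.isFull (Or.inr h) d.2).2.1 c.2, sub_zero]
    rfl
  · simp only [dartCochain]
    rcases eq_or_ne d c with rfl | hne
    · rw [if_pos (show EdgeRel _ _ from Or.inl (DartRel.refl _)), Pi.single_eq_same]
    · rw [Pi.single_eq_of_ne hne, if_neg fun h => hne (HalfEdgeType.eq_of_edgeRel h)]

lemma dartCochain_isDiag (hN : 4 ≤ N) {y : ZMod N × ZMod N} (h : IsDiag y) :
    dartCochain y = 0 := by
  ext d
  · simp only [dartCochain]
    rw [if_neg fun h' => (EdgeRel.isFull (Or.inl h') d.2).2.2 h,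
      if_neg fun h' => (EdgeRel.isFull (Or.inr h') d.2).2.2 h, sub_zero]
    rfl
  · exact if_neg fun h' => h.not_isHalf hN (h'.isHalf d.2)

lemma two_smul_dartCochain_isHalf {y : ZMod N × ZMod N} (h : IsHalf y) :
    dartCochain y + dartCochain y = 0 := by
  ext d
  · simp only [dartCochain, Prod.fst_add, Pi.add_apply]
    rw [if_neg fun h' => (EdgeRel.isFull (Or.inl h') d.2).2.1 h,
      if_neg fun h' => (EdgeRel.isFull (Or.inr h') d.2).2.1 h, sub_zero]
    rfl
  · exact CharTwo.add_self_eq_zero _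

lemma ite_dartRel_sum {z : ZMod N × ZMod N} (hz : IsFree z) (x : ZMod N × ZMod N) {R : Type}
    [AddMonoidWithOne R] :
    (if DartRel x z then (1 : R) else 0) + (if DartRel x (rot z) then 1 else 0)
      + (if DartRel x (rot (rot z)) then 1 else 0) = if VertexRel x z then 1 else 0 := by
  have h0 : VertexRel x z ↔ DartRel x z ∨ DartRel x (rot z) ∨ DartRel x (rot (rot z)) :=
    ⟨fun h => h.symm.imp DartRel.symm (Or.imp DartRel.symm DartRel.symm),
      fun h => VertexRel.symm (h.imp DartRel.symm (Or.imp DartRel.symm DartRel.symm))⟩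
  have h1 (h : DartRel x z) (h' : DartRel x (rot z)) : False :=
    hz.not_dartRel_rot (h'.symm.trans h)
  have h2 (h : DartRel x (rot z)) (h' : DartRel x (rot (rot z))) : False :=
    hz.rot.not_dartRel_rot (h'.symm.trans h)
  have h3 (h : DartRel x (rot (rot z))) (h' : DartRel x z) : False :=
    hz.rot.rot.not_dartRel_rot (by rw [rot_rot_rot]; exact h'.symm.trans h)
  rw [h0]
  by_cases a : DartRel x z <;> by_cases b : DartRel x (rot z) <;>
    by_cases c : DartRel x (rot (rot z)) <;> simp_all

lemma edgeRel_iff_of_not_isFree {x y : ZMod N × ZMod N} (hx : ¬ IsFree (bar x)) (hy : IsFree y) :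
    EdgeRel x y ↔ DartRel x y :=
  or_iff_left fun h => hx (h.symm.isFree hy)

lemma dartCochain_sum_isFree {z : ZMod N × ZMod N} (hz : IsFree z) :
    dartCochain z + dartCochain (rot z) + dartCochain (rot (rot z))
      = coboundary edgeSource edgeTarget halfEdgeVertex (Pi.single (vertex z hz) 1) := by
  ext c
  · have h1 := ite_dartRel_sum (R := ℤ) hz c.1.out
    have h2 := ite_dartRel_sum (R := ℤ) hz (bar c.1.out)
    simp only [dartCochain, coboundary, LinearMap.coe_mk, AddHom.coe_mk, Prod.fst_add,
      Pi.add_apply, Pi.single_apply, edgeSource, edgeTarget, vertex_eq_iff]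
    rw [← h1, ← h2]
    ring
  · simp only [dartCochain, coboundary, LinearMap.coe_mk, AddHom.coe_mk, Prod.snd_add,
      Pi.add_apply, Pi.single_apply, halfEdgeVertex]
    have h1 := ite_dartRel_sum (R := ZMod 2) hz c.1.out
    have h2 := ite_dartRel_sum (R := ZMod 2) hz (bar c.1.out)
    by_cases h : IsFree c.1.out
    · have key {y : ZMod N × ZMod N} (hy : IsFree y) : EdgeRel c.1.out y ↔ DartRel c.1.out y := by
        by_cases hb : IsFree (bar c.1.out)
        · exact or_iff_left_of_imp (c.2.dartRel_bar h hb).trans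
        · exact edgeRel_iff_of_not_isFree hb hy
      simp only [dif_pos h, Option.elim_some, vertex_eq_iff, key hz, key hz.rot, key hz.rot.rot,
        Int.cast_ite, Int.cast_one, Int.cast_zero]
      exact h1
    have key {y : ZMod N × ZMod N} (hy : IsFree y) :
        EdgeRel c.1.out y ↔ DartRel (bar c.1.out) y :=
      or_iff_right fun h' => h (h'.symm.isFree hy)
    by_cases h' : IsFree (bar c.1.out)
    · simp only [dif_neg h, dif_pos h', Option.elim_some, vertex_eq_iff, key hz, key hz.rot,
        key hz.rot.rot, Int.cast_ite, Int.cast_one, Int.cast_zero]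
      exact h2
    · have key' {y : ZMod N × ZMod N} (hy : IsFree y) : ¬ EdgeRel c.1.out y :=
        fun hE => h' (((key hy).1 hE).symm.isFree hy)
      simp only [dif_neg h, dif_neg h', Option.elim_none, key' hz, key' hz.rot, key' hz.rot.rot,
        if_false, add_zero]

lemma dartCochain_sum_of_not_isFree (hN : 4 ≤ N) {z : ZMod N × ZMod N} (h : IsCoprime z.1 z.2)
    (hz : ¬ IsFree z) :
    dartCochain z + dartCochain (rot z) + dartCochain (rot (rot z)) = 0 := by
  have key {y : ZMod N × ZMod N} (hy : IsCoprime y.1 y.2) (h0 : y.1 = 0 ∨ y.1 = y.2) :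
      dartCochain y + dartCochain (rot y) + dartCochain (rot (rot y)) = 0 := by
    rcases h0 with h0 | h0
    · rw [dartCochain_isDiag hN (y := rot y) ⟨isCoprime_rot hy, Or.inr (by simp [rot, h0])⟩, add_zero,
        dartCochain_of_dartRel (z := y) (y := rot (rot y))
          (by rw [rot_rot]; right; right; right; simp [h0])]
      exact two_smul_dartCochain_isHalf ⟨hy, by simp [h0]⟩
    · rw [dartCochain_isDiag hN (y := y) ⟨hy, Or.inl h0⟩, zero_add,
        dartCochain_of_dartRel (z := rot y) (y := rot (rot y))
          (by rw [rot_rot]; right; left; simp [rot, h0])]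
      exact two_smul_dartCochain_isHalf ⟨isCoprime_rot hy, Or.inr (by grind [rot])⟩
  have hcase : (z.1 = 0 ∨ z.1 = z.2) ∨ ((rot z).1 = 0 ∨ (rot z).1 = (rot z).2) ∨
      ((rot (rot z)).1 = 0 ∨ (rot (rot z)).1 = (rot (rot z)).2) := by
    simp only [IsFree, h, true_and] at hz
    simp only [rot]
    clear h key
    grind
  rcases hcase with h0 | h0 | h0
  · exact key h h0
  · have := key (isCoprime_rot h) h0
    rw [rot_rot_rot] at this
    rw [← this]; abel
  · have := key (isCoprime_rot (isCoprime_rot h)) h0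
    rw [rot_rot_rot] at this
    rw [← this]; abel

/-- The symbol of a pair. -/
noncomputable abbrev psym (y : ZMod N × ZMod N) : MnMinus 2 (ZMod N) := sym y.1 y.2

lemma psym_of_dartRel {y z : ZMod N × ZMod N} (h : DartRel z y) : psym y = psym z := by
  rcases h with ⟨h1, h2⟩ | ⟨h1, h2⟩ | ⟨h1, h2⟩ | ⟨h1, h2⟩ <;>
    simp only [psym, h1, h2, sym_neg_left, sym_neg_right, neg_neg] <;> exact sym_swap _ _

lemma psym_bar (y : ZMod N × ZMod N) : psym (bar y) = -psym y := sym_neg_left _ _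

lemma sym_self (u : ZMod N) : sym u (-u) = 0 := by
  have := sym_triangle u (-u)
  rw [show -u - -u = 0 by ring] at this
  have h0 : sym (-u) 0 + sym 0 u = 0 := by rw [sym_neg_left, sym_swap 0 u, neg_add_cancel]
  rwa [add_assoc, h0, add_zero] at this

lemma psym_isDiag {y : ZMod N × ZMod N} (h : IsDiag y) : psym y = 0 := by
  rcases h.2 with h | h <;> rw [psym, h]
  · rw [← neg_neg (sym _ _), ← sym_neg_right, sym_self, neg_zero]
  · rw [sym_neg_left, ← sym_neg_right, sym_self]

lemma two_smul_psym_isHalf {y : ZMod N × ZMod N} (h : IsHalf y) : psym y + psym y = 0 := by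
  have h2 (a b : ZMod N) (ha : 2 * a = 0) : sym a b + sym a b = 0 := by
    have : -a = a := by linear_combination -ha
    nth_rewrite 1 [← this]
    rw [sym_neg_left, neg_add_cancel]
  have hd (u : ZMod N) : sym u (2 * u) + sym u (2 * u) = 0 := by
    have := sym_triangle u u
    have h0 : sym u u = 0 := by rw [← neg_neg (sym u u), ← sym_neg_right, sym_self, neg_zero]
    rw [h0, zero_add, show -u - u = -(2 * u) by ring, sym_neg_right, sym_neg_left,
      sym_swap u (2 * u), ← neg_add, neg_eq_zero] at this
    exact this
  rcases h.2 with (h | h) | h | h | h | h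
  · exact h2 _ _ h
  · rw [psym, ← sym_swap]; exact h2 _ _ h
  · rw [psym, h]; exact hd _
  · rw [psym, h, neg_mul, sym_neg_right, ← neg_add, hd, neg_zero]
  · rw [psym, h, sym_swap]; exact hd _
  · rw [psym, h, neg_mul, sym_neg_left, sym_swap, ← neg_add, hd, neg_zero]

variable [NeZero N]

/-- A homomorphism out of `ℤ/2` sending `1` to a given element killed by two. -/
def zmodTwoHom {B : Type} [AddCommGroup B] (m : B) (hm : m + m = 0) : ZMod 2 →+ B :=
  ZMod.lift 2 ⟨zmultiplesHom B m, by simpa [two_zsmul] using hm⟩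

lemma zmodTwoHom_one {B : Type} [AddCommGroup B] (m : B) (hm : m + m = 0) :
    zmodTwoHom m hm 1 = m := by
  have := ZMod.lift_coe 2 ⟨zmultiplesHom B m, by simpa [two_zsmul] using hm⟩ 1
  rw [Int.cast_one] at this
  exact this.trans (one_zsmul m)

noncomputable instance : Fintype (EdgeType N) := Fintype.ofFinite _
noncomputable instance : Fintype (HalfEdgeType N) := Fintype.ofFinite _
noncomputable instance : Fintype (VertexType N) := Fintype.ofFinite _

/-- The presentation of `M₂⁻(ℤ/N)` by edges and half-edges. -/
noncomputable def presentation (N : ℕ) [NeZero N] :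
    (EdgeType N → ℤ) × (HalfEdgeType N → ZMod 2) →ₗ[ℤ] MnMinus 2 (ZMod N) :=
  LinearMap.coprod
    (LinearMap.lsum ℤ _ ℤ fun e => LinearMap.toSpanSingleton ℤ _ (psym e.1.out))
    (LinearMap.lsum ℤ _ ℤ fun c =>
      (zmodTwoHom (psym c.1.out) (two_smul_psym_isHalf c.2)).toIntLinearMap)

lemma presentation_edge (e : EdgeType N) :
    presentation N (Pi.single e 1, 0) = psym e.1.out := by
  simp [presentation]

lemma presentation_halfEdge (c : HalfEdgeType N) :
    presentation N (0, Pi.single c 1) = psym c.1.out := by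
  simp only [presentation, LinearMap.coprod_apply, map_zero, zero_add, LinearMap.lsum_piSingle]
  exact zmodTwoHom_one _ (two_smul_psym_isHalf c.2)

lemma presentation_dartCochain (hN : 4 ≤ N) {y : ZMod N × ZMod N} (hy : IsCoprime y.1 y.2) :
    presentation N (dartCochain y) = psym y := by
  have key {x : ZMod N × ZMod N} (hx : presentation N (dartCochain x) = psym x)
      (h : EdgeRel x y) : presentation N (dartCochain y) = psym y := by
    rcases h with h | h
    · rw [dartCochain_of_dartRel h, psym_of_dartRel h, hx]
    · rw [dartCochain_of_dartRel h, psym_of_dartRel h, dartCochain_bar, psym_bar, map_neg, hx]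
  by_cases h : IsHalf y
  · refine key (x := (halfEdge y h).1.out) ?_ (edgeRel_out y)
    rw [dartCochain_out_halfEdge, presentation_halfEdge]
  by_cases h' : IsDiag y
  · rw [dartCochain_isDiag hN h', psym_isDiag h', map_zero]
  · refine key (x := (edge y ⟨hy, h, h'⟩).1.out) ?_ (edgeRel_out y)
    rw [dartCochain_out_edge, presentation_edge]

lemma presentation_surjective (hN : 4 ≤ N) : Function.Surjective (presentation N) := by
  have : (presentation N).toAddMonoidHom.range = ⊤ := by
    rw [eq_top_iff, ← closure_sym, AddSubgroup.closure_le]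
    rintro _ ⟨a, b, h, rfl⟩
    exact ⟨dartCochain (a, b), presentation_dartCochain hN (y := (a, b)) h⟩
  exact AddMonoidHom.range_eq_top.1 this

lemma presentation_comp_coboundary (hN : 4 ≤ N) :
    presentation N ∘ₗ coboundary edgeSource edgeTarget halfEdgeVertex = 0 := by
  refine LinearMap.pi_ext' fun v => LinearMap.ext_ring ?_
  change presentation N (coboundary _ _ _ (Pi.single v 1)) = 0
  have hv : v = vertex v.1.out v.2 := Subtype.ext (Quotient.out_eq v.1).symm
  rw [hv, ← dartCochain_sum_isFree, map_add, map_add, presentation_dartCochain hN v.2.1,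
    presentation_dartCochain hN v.2.rot.1, presentation_dartCochain hN v.2.rot.rot.1, rot_rot]
  exact sym_triangle _ _

lemma ker_presentation (hN : 4 ≤ N) : LinearMap.ker (presentation N)
    = LinearMap.range (coboundary edgeSource edgeTarget halfEdgeVertex) := by
  set R := LinearMap.range (coboundary (edgeSource (N := N)) edgeTarget halfEdgeVertex) with hR
  apply le_antisymm
  · obtain ⟨φ, hφ⟩ := exists_lift (N := N) (fun a b => R.mkQ (dartCochain (a, b)))
      (fun a b => by
        rw [dartCochain_of_dartRel (z := (a, b)) (y := (b, a)) (Or.inr (Or.inl ⟨rfl, rfl⟩))])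
      (fun a b => by
        rw [← map_neg, ← dartCochain_bar]; rfl)
      (fun u v h => by
        have hz : dartCochain (u, v) + dartCochain (v, -u - v) + dartCochain (-u - v, u) ∈ R := by
          have h3 := rot_rot (u, v)
          by_cases hf : IsFree (u, v)
          · exact ⟨_, (h3 ▸ dartCochain_sum_isFree hf).symm⟩
          · have := dartCochain_sum_of_not_isFree hN h hf
            rw [h3] at this
            exact this ▸ R.zero_mem
        rw [← map_add, ← map_add]
        exact (Submodule.Quotient.mk_eq_zero _).2 hz)
    have hcomp : φ.toIntLinearMap ∘ₗ presentation N = R.mkQ := by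
      refine LinearMap.prod_ext (LinearMap.pi_ext' fun e => LinearMap.ext_ring ?_)
        (LinearMap.pi_ext' fun c => ?_)
      · change φ (presentation N (Pi.single e 1, 0)) = R.mkQ (Pi.single e 1, 0)
        rw [presentation_edge, ← dartCochain_out_edge]
        exact hφ _ _ e.2.1
      · ext x
        have h1 : φ (presentation N (0, Pi.single c 1)) = R.mkQ (0, Pi.single c 1) := by
          rw [presentation_halfEdge, ← dartCochain_out_halfEdge]
          exact hφ _ _ c.2.1
        have h0 : φ (presentation N (0, Pi.single c 0)) = R.mkQ (0, Pi.single c 0) := by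
          rw [Pi.single_zero, Prod.mk_zero_zero, map_zero, map_zero, map_zero]
        fin_cases x
        · exact h0
        · exact h1
    intro x hx
    rw [← Submodule.ker_mkQ R, LinearMap.mem_ker, ← hcomp, LinearMap.comp_apply,
      LinearMap.mem_ker.1 hx, map_zero]
  · rw [hR, LinearMap.range_le_ker_iff]
    exact presentation_comp_coboundary hN

end Presentation
end KPT

namespace KPT

section Connectivity

open Classical

variable {N : ℕ} {B : Type} (f : VertexType N → B)

/-- A function on vertices as a partial function on pairs. -/
noncomputable def onFree (y : ZMod N × ZMod N) : Option B :=
  if h : IsFree y then some (f (vertex y h)) else none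

lemma onFree_of_vertexRel {y z : ZMod N × ZMod N} (h : VertexRel z y) : onFree f y = onFree f z := by
  by_cases hz : IsFree z
  · rw [onFree, onFree, dif_pos hz, dif_pos (h.isFree hz), (vertex_eq_iff hz (h.isFree hz)).2 h]
  · rw [onFree, onFree, dif_neg hz, dif_neg fun hy => hz (h.symm.isFree hy)]

lemma onFree_swap (a b : ZMod N) : onFree f (b, a) = onFree f (a, b) :=
  onFree_of_vertexRel f (Or.inl (Or.inr (Or.inl ⟨rfl, rfl⟩)))

lemma onFree_neg (a b : ZMod N) : onFree f (-a, -b) = onFree f (a, b) :=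
  onFree_of_vertexRel f (Or.inl (Or.inr (Or.inr (Or.inl ⟨rfl, rfl⟩))))

variable {f}

lemma onFree_bar (hf : ∀ e, f (edgeSource e) = f (edgeTarget e)) {y : ZMod N × ZMod N}
    (hy : IsFree y) (hy' : IsFree (bar y)) : onFree f (bar y) = onFree f y := by
  by_cases h : IsHalf y
  · exact onFree_of_vertexRel f (Or.inl (h.dartRel_bar hy hy'))
  have hd : ¬ IsDiag y := fun h => by
    have h1 := h.2
    have h2 := hy.2
    have h3 := hy'.2
    simp only [bar] at h3
    grind
  have he := hf (edge y ⟨hy.1, h, hd⟩)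
  have hfull := (edge y ⟨hy.1, h, hd⟩).2
  have key : onFree f (bar (edge y ⟨hy.1, h, hd⟩).1.out) = onFree f (edge y ⟨hy.1, h, hd⟩).1.out := by
    rw [onFree, onFree, dif_pos hfull.isFree, dif_pos hfull.bar.isFree]
    exact congr_arg some he.symm
  rcases edgeRel_out y with h | h
  · exact (onFree_of_vertexRel f (Or.inl h.bar)).trans
      (key.trans (onFree_of_vertexRel f (Or.inl h)).symm)
  · have h' := h.bar
    rw [bar_bar] at h'
    exact (onFree_of_vertexRel f (Or.inl h')).trans
      (key.symm.trans (onFree_of_vertexRel f (Or.inl h)).symm)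

variable (f) in
/-- The extension of a function on vertices to all generating pairs. -/
noncomputable def extendToPairs (y : ZMod N × ZMod N) : Option B :=
  if IsFree y then onFree f y else
    if y.1 = 0 ∨ y.1 + 2 * y.2 = 0 then onFree f (y.2, 2 * y.2) else onFree f (y.1, 2 * y.1)

lemma extendToPairs_of_isFree {y : ZMod N × ZMod N} (hy : IsFree y) :
    extendToPairs f y = onFree f y := if_pos hy

lemma natCast_mul_ne_zero {u : ZMod N} (hu : IsUnit u) {k : ℕ} (hk : 0 < k) (hk' : k < N) :
    (k : ZMod N) * u ≠ 0 := fun h => by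
  rw [hu.mul_left_eq_zero, ZMod.natCast_eq_zero_iff] at h
  exact absurd (Nat.le_of_dvd hk h) (by omega)

lemma isUnit_ne (hN : 6 ≤ N) {u : ZMod N} (hu : IsUnit u) :
    u ≠ 0 ∧ 2 * u ≠ 0 ∧ 3 * u ≠ 0 ∧ 4 * u ≠ 0 ∧ 5 * u ≠ 0 := by
  have h1 := natCast_mul_ne_zero hu (k := 1) (by norm_num) (by omega)
  have h2 := natCast_mul_ne_zero hu (k := 2) (by norm_num) (by omega)
  have h3 := natCast_mul_ne_zero hu (k := 3) (by norm_num) (by omega)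
  have h4 := natCast_mul_ne_zero hu (k := 4) (by norm_num) (by omega)
  have h5 := natCast_mul_ne_zero hu (k := 5) (by norm_num) (by omega)
  simp only [Nat.cast_one, one_mul, Nat.cast_ofNat] at *
  exact ⟨h1, h2, h3, h4, h5⟩

lemma isFree_two_mul (hN : 6 ≤ N) {u : ZMod N} (hu : IsUnit u) : IsFree (u, 2 * u) := by
  have := isUnit_ne hN hu
  obtain ⟨c, hc⟩ := hu.exists_left_inv
  refine ⟨⟨c, 0, by simp [hc]⟩, ?_⟩
  simp only
  clear hc
  grind

lemma extendToPairs_eq (hN : 6 ≤ N) {u : ZMod N} (hu : IsUnit u) :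
    extendToPairs f (0, u) = onFree f (u, 2 * u) ∧
    extendToPairs f (u, 0) = onFree f (u, 2 * u) ∧
    extendToPairs f (u, -u) = onFree f (u, 2 * u) ∧
    extendToPairs f (u, u) = onFree f (u, 2 * u) ∧
    extendToPairs f (u, -(2 * u)) = onFree f (u, 2 * u) ∧
    extendToPairs f (-(2 * u), u) = onFree f (u, 2 * u) := by
  have := isUnit_ne hN hu
  clear hu
  simp only [extendToPairs, IsFree]
  grind

lemma exists_of_not_isFree {y : ZMod N × ZMod N} (hc : IsCoprime y.1 y.2) (hy : ¬ IsFree y) :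
    ∃ u, IsUnit u ∧ (y = (0, u) ∨ y = (u, 0) ∨ y = (u, -u) ∨ y = (u, u) ∨ y = (u, -(2 * u)) ∨
      y = (-(2 * u), u)) := by
  obtain ⟨a, b⟩ := y
  obtain ⟨p, q, h⟩ := hc
  simp only at h
  simp only [IsFree, not_and_or, not_not] at hy
  rcases hy with hy | hy | hy | hy | hy | hy | hy
  · exact (hy ⟨p, q, h⟩).elim
  · exact ⟨b, .of_mul_eq_one q (by grind), by grind⟩
  · exact ⟨a, .of_mul_eq_one p (by grind), by grind⟩
  · exact ⟨a, .of_mul_eq_one (p - q) (by grind), by grind⟩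
  · exact ⟨a, .of_mul_eq_one (p + q) (by grind), by grind⟩
  · exact ⟨a, .of_mul_eq_one (p - 2 * q) (by grind), by grind⟩
  · exact ⟨b, .of_mul_eq_one (q - 2 * p) (by grind), by grind⟩

lemma onFree_neg_two_mul (u : ZMod N) : onFree f (-u, 2 * -u) = onFree f (u, 2 * u) := by
  rw [mul_neg, onFree_neg]

lemma extendToPairs_swap (hN : 6 ≤ N) {y : ZMod N × ZMod N} (hc : IsCoprime y.1 y.2) :
    extendToPairs f (y.2, y.1) = extendToPairs f y := by
  by_cases hy : IsFree y
  · rw [extendToPairs_of_isFree hy, extendToPairs_of_isFree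
      (DartRel.isFree (Or.inr (Or.inl ⟨rfl, rfl⟩)) hy), onFree_swap]
  · obtain ⟨u, hu, h⟩ := exists_of_not_isFree hc hy
    have h1 := extendToPairs_eq (f := f) hN hu
    have h2 := extendToPairs_eq (f := f) hN hu.neg
    rw [onFree_neg_two_mul, neg_neg] at h2
    rcases h with rfl | rfl | rfl | rfl | rfl | rfl <;> simp only [h1, h2]

lemma extendToPairs_rot (hN : 6 ≤ N) {y : ZMod N × ZMod N} (hc : IsCoprime y.1 y.2) :
    extendToPairs f (rot y) = extendToPairs f y := by
  by_cases hy : IsFree y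
  · rw [extendToPairs_of_isFree hy, extendToPairs_of_isFree hy.rot]
    exact onFree_of_vertexRel f (Or.inr (Or.inl (DartRel.refl _)))
  · obtain ⟨u, hu, h⟩ := exists_of_not_isFree hc hy
    have h1 := extendToPairs_eq (f := f) hN hu
    have h2 := extendToPairs_eq (f := f) hN hu.neg
    rw [onFree_neg_two_mul, neg_neg] at h2
    rcases h with rfl | rfl | rfl | rfl | rfl | rfl <;> simp only [h1, rot]
    · rw [neg_zero, zero_sub, h1.2.2.1]
    · rw [sub_zero, h2.1]
    · rw [sub_neg_eq_add, neg_add_cancel, h2.2.1]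
    · rw [show -u - u = -(2 * u) by ring, h1.2.2.2.2.1]
    · rw [show -u - -(2 * u) = u by ring, h1.2.2.2.2.2]
    · rw [show - -(2 * u) - u = u by ring, h1.2.2.2.1]

lemma extendToPairs_bar (hN : 6 ≤ N) (hf : ∀ e, f (edgeSource e) = f (edgeTarget e))
    {y : ZMod N × ZMod N} (hc : IsCoprime y.1 y.2) :
    extendToPairs f (bar y) = extendToPairs f y := by
  have key {y : ZMod N × ZMod N} (hc : IsCoprime y.1 y.2) (hy : ¬ IsFree y) :
      extendToPairs f (bar y) = extendToPairs f y := by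
    obtain ⟨u, hu, h⟩ := exists_of_not_isFree hc hy
    have h1 := extendToPairs_eq (f := f) hN hu
    have h2 := extendToPairs_eq (f := f) hN hu.neg
    have hfree := isFree_two_mul hN hu
    rw [onFree_neg_two_mul, neg_neg] at h2
    rcases h with rfl | rfl | rfl | rfl | rfl | rfl <;> simp only [h1, bar]
    · rw [neg_zero, h1.1]
    · rw [h2.2.1]
    · rw [h2.2.2.2.1]
    · rw [h2.2.2.1]
    · rw [extendToPairs_of_isFree (DartRel.isFree (Or.inr (Or.inr (Or.inl ⟨rfl, rfl⟩))) hfree),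
        onFree_neg]
    · rw [neg_neg, extendToPairs_of_isFree (DartRel.isFree (Or.inr (Or.inl ⟨rfl, rfl⟩)) hfree),
        onFree_swap]
  by_cases hy : IsFree y
  · by_cases hy' : IsFree (bar y)
    · rw [extendToPairs_of_isFree hy, extendToPairs_of_isFree hy', onFree_bar hf hy hy']
    · have := key (isCoprime_bar hc) hy'
      rw [bar_bar] at this
      exact this.symm
  · exact key hc hy

lemma extendToPairs_add_mul [NeZero N] (hN : 6 ≤ N)
    (hf : ∀ e, f (edgeSource e) = f (edgeTarget e)) {a b : ZMod N} (hc : IsCoprime a b)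
    (k : ZMod N) : extendToPairs f (a + k * b, b) = extendToPairs f (a, b) := by
  have step {a b : ZMod N} (hc : IsCoprime a b) :
      extendToPairs f (a + b, b) = extendToPairs f (a, b) := by
    have hr : IsCoprime (rot (a, b)).1 (rot (a, b)).2 := isCoprime_rot (z := (a, b)) hc
    rw [← extendToPairs_rot hN (y := (a, b)) hc, ← extendToPairs_swap hN hr,
      ← extendToPairs_bar hN hf (y := ((rot (a, b)).2, (rot (a, b)).1)) hr.symm]
    simp only [bar, rot]
    rw [neg_sub, sub_neg_eq_add, add_comm]
  have nat (k : ℕ) : extendToPairs f (a + k * b, b) = extendToPairs f (a, b) := by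
    induction k with
    | zero => simp
    | succ k ih =>
      rw [Nat.cast_succ, add_mul, one_mul, ← add_assoc, step ?_, ih]
      rwa [IsCoprime.add_mul_right_left_iff]
  rw [← ZMod.natCast_zmod_val k]
  exact nat _

lemma extendToPairs_const [NeZero N] (hN : 6 ≤ N)
    (hf : ∀ e, f (edgeSource e) = f (edgeTarget e)) {y : ZMod N × ZMod N}
    (hc : IsCoprime y.1 y.2) : extendToPairs f y = extendToPairs f (0, 1) := by
  have gcd (m n : ℕ) : IsCoprime (m : ZMod N) (n : ZMod N) →
      ∃ d, IsUnit d ∧ extendToPairs f (m, n) = extendToPairs f (0, d) := by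
    induction m, n using Nat.gcd.induction with
    | H0 n => exact fun h => ⟨n, isCoprime_zero_left.1 (by simpa using h), by simp⟩
    | H1 m n _ ih =>
      intro h
      have hn : (n : ZMod N) = (n % m : ℕ) + (n / m : ℕ) * m := by
        exact_mod_cast congr_arg (Nat.cast (R := ZMod N)) (Nat.mod_add_div' n m).symm
      have h' : IsCoprime ((n % m : ℕ) : ZMod N) (m : ZMod N) := by
        rw [hn] at h
        exact IsCoprime.add_mul_right_left_iff.1 h.symm
      obtain ⟨d, hd, e⟩ := ih h'
      refine ⟨d, hd, ?_⟩
      rw [← e, ← extendToPairs_add_mul hN hf h' (n / m : ℕ), ← hn]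
      exact (extendToPairs_swap hN (y := ((m : ZMod N), (n : ZMod N))) h).symm
  obtain ⟨a, b⟩ := y
  obtain ⟨d, hd, e⟩ := gcd a.val b.val (by simpa using hc)
  rw [ZMod.natCast_zmod_val, ZMod.natCast_zmod_val] at e
  obtain ⟨c, hcd⟩ := hd.exists_left_inv
  rw [e, ← extendToPairs_add_mul hN hf (isCoprime_zero_left.2 hd) c, zero_add, hcd,
    ← extendToPairs_swap hN (y := (1, d)) isCoprime_one_left,
    ← extendToPairs_add_mul hN hf (a := d) isCoprime_one_right (-d), mul_one, add_neg_cancel]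

lemma isConnectedGraph [NeZero N] (hN : 6 ≤ N) :
    IsConnectedGraph (edgeSource (N := N)) edgeTarget := by
  intro B f hf v w
  have key (v : VertexType N) : some (f v) = extendToPairs f (0, 1) := by
    rw [← extendToPairs_const hN hf v.2.1, extendToPairs_of_isFree v.2, onFree, dif_pos v.2]
    exact congr_arg _ (congr_arg f (Subtype.ext (Quotient.out_eq v.1).symm))
  exact Option.some_injective _ ((key v).trans (key w).symm)

end Connectivity
end KPT

namespace KPT

section Classes

open Classical Finset

lemma card_filter_eq_mul_card_classes {α : Type} [Fintype α] (s : Setoid α) (p : α → Prop)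
    [Fintype {c : Quotient s // p c.out}] (hp : ∀ z y, s z y → p z → p y) (k : ℕ)
    (hk : ∀ z, p z → #{y | s z y} = k) :
    #{y | p y} = k * Fintype.card {c : Quotient s // p c.out} := by
  have hout (z : α) : s (Quotient.mk s z).out z := Quotient.exact (Quotient.out_eq _)
  rw [Finset.card_eq_sum_card_fiberwise (f := Quotient.mk s)
    (t := univ.image (Subtype.val : {c : Quotient s // p c.out} → Quotient s))]
  · rw [Finset.sum_const_nat (m := k), Finset.card_image_of_injective _ Subtype.val_injective,
      Finset.card_univ, mul_comm]
    intro c hc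
    obtain ⟨⟨c, hpc⟩, rfl⟩ : ∃ d : {c : Quotient s // p c.out}, d.1 = c := by simpa using hc
    rw [← hk _ hpc, Finset.filter_filter]
    congr 1
    ext y
    simp only [Finset.mem_filter, Finset.mem_univ, true_and]
    constructor
    · rintro ⟨-, rfl⟩
      exact hout y
    · intro h
      exact ⟨hp _ _ h hpc, (Quotient.sound h).symm.trans (Quotient.out_eq c)⟩
  · intro y hy
    simp only [Finset.coe_filter, Finset.mem_univ, true_and, Set.mem_ofPred_eq] at hy
    simp only [Finset.coe_image, Set.mem_image]
    exact ⟨⟨Quotient.mk s y, hp _ _ (s.symm (hout y)) hy⟩, by simp, rfl⟩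

variable {N : ℕ} [NeZero N]

lemma card_dartRel {z : ZMod N × ZMod N} (h1 : z.1 ≠ z.2) (h2 : z.1 ≠ -z.2)
    (h3 : ¬ (2 * z.1 = 0 ∧ 2 * z.2 = 0)) : #{y | DartRel z y} = 4 := by
  have : ({y | DartRel z y} : Finset (ZMod N × ZMod N)) =
      {(z.1, z.2), (z.2, z.1), (-z.1, -z.2), (-z.2, -z.1)} := by
    ext y
    rw [Finset.mem_filter]
    simp [DartRel, Prod.ext_iff]
  rw [this, Finset.card_insert_of_notMem, Finset.card_insert_of_notMem,
    Finset.card_insert_of_notMem, Finset.card_singleton]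
  all_goals
    simp only [Finset.mem_insert, Finset.mem_singleton, Prod.mk.injEq]
    grind

lemma two_mul_ne_zero_of_isCoprime {N : ℕ} (hN : 3 ≤ N) {a b : ZMod N} (h : IsCoprime a b) :
    ¬ (2 * a = 0 ∧ 2 * b = 0) := by
  rintro ⟨ha, hb⟩
  obtain ⟨u, v, h⟩ := h
  have h2 : ((2 : ℕ) : ZMod N) = 0 := by push_cast; linear_combination -2 * h + u * ha + v * hb
  have := Nat.le_of_dvd two_pos ((ZMod.natCast_eq_zero_iff _ _).1 h2)
  omega

lemma card_edgeRel {z : ZMod N × ZMod N} (h1 : z.1 ≠ z.2) (h2 : z.1 ≠ -z.2)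
    (h3 : ¬ (2 * z.1 = 0 ∧ 2 * z.2 = 0)) (h : ¬ DartRel (bar z) z) :
    #{y | EdgeRel z y} = 8 := by
  have : ({y | EdgeRel z y} : Finset (ZMod N × ZMod N)) =
      ({y | DartRel z y} : Finset _) ∪ ({y | DartRel (bar z) y} : Finset _) := by
    ext y
    simp only [mem_filter, mem_union, mem_univ, true_and]
    exact Iff.rfl
  rw [this, Finset.card_union_of_disjoint, card_dartRel h1 h2 h3, card_dartRel]
  · simp only [bar]; grind
  · simp only [bar]; grind
  · simp only [bar]; grind
  · rw [Finset.disjoint_filter]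
    exact fun y _ hy hy' => h (hy'.trans hy.symm)

lemma card_vertexRel (hN : 3 ≤ N) {z : ZMod N × ZMod N} (h : IsFree z) :
    #{y | VertexRel z y} = 12 := by
  have key {z : ZMod N × ZMod N} (h : IsFree z) : #{y | DartRel z y} = 4 := by
    have h3 := two_mul_ne_zero_of_isCoprime hN h.1
    have := h.2
    refine card_dartRel ?_ ?_ h3 <;> grind
  have hd := h.not_dartRel_rot
  have hd1 := h.rot.not_dartRel_rot
  have hd2 := h.rot.rot.not_dartRel_rot
  rw [rot_rot_rot] at hd2
  have : ({y | VertexRel z y} : Finset (ZMod N × ZMod N)) = ({y | DartRel z y} : Finset _) ∪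
      (({y | DartRel (rot z) y} : Finset _) ∪ ({y | DartRel (rot (rot z)) y} : Finset _)) := by
    ext y
    simp only [mem_filter, mem_union, mem_univ, true_and]
    exact Iff.rfl
  rw [this, Finset.card_union_of_disjoint, Finset.card_union_of_disjoint, key h, key h.rot, key h.rot.rot]
  · rw [Finset.disjoint_filter]
    exact fun y _ hy hy' => hd1 (hy'.trans hy.symm)
  · rw [Finset.disjoint_union_right, Finset.disjoint_filter, Finset.disjoint_filter]
    exact ⟨fun y _ hy hy' => hd (hy'.trans hy.symm), fun y _ hy hy' => hd2 (hy.trans hy'.symm)⟩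

end Classes

section Lines

open Classical Finset

variable {N : ℕ} [NeZero N]

/-- The pairs `(u, k u)` with `u` a unit. -/
noncomputable def lineLeft (k : ZMod N) : Finset (ZMod N × ZMod N) :=
  {z | IsUnit z.1 ∧ z.2 = k * z.1}

/-- The pairs `(k u, u)` with `u` a unit. -/
noncomputable def lineRight (k : ZMod N) : Finset (ZMod N × ZMod N) :=
  {z | IsUnit z.2 ∧ z.1 = k * z.2}

lemma card_filter_isUnit : #{u : ZMod N | IsUnit u} = N.totient := by
  rw [← ZMod.card_units_eq_totient, ← Finset.card_univ,
    ← Finset.card_image_of_injective _ Units.val_injective]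
  congr 1
  ext u
  rw [mem_filter]
  simp [IsUnit]

lemma card_lineLeft (k : ZMod N) : #(lineLeft k) = N.totient := by
  rw [← card_filter_isUnit, ← Finset.card_image_of_injective (f := fun u => (u, k * u))]
  · congr 1
    ext z
    simp only [lineLeft, mem_filter, mem_univ, true_and, mem_image, Prod.ext_iff]
    constructor
    · exact fun h => ⟨z.1, h.1, rfl, h.2.symm⟩
    · rintro ⟨u, hu, h1, h2⟩
      exact ⟨h1 ▸ hu, by rw [← h2, h1]⟩
  · exact fun u v h => (Prod.ext_iff.1 h).1

lemma card_lineRight (k : ZMod N) : #(lineRight k) = N.totient := by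
  rw [← card_lineLeft k, ← Finset.card_image_of_injective _ Prod.swap_injective]
  congr 1
  ext z
  simp [lineLeft, lineRight, Prod.ext_iff]

lemma disjoint_lineLeft {k l : ZMod N} (h : ∀ u, IsUnit u → k * u ≠ l * u) :
    Disjoint (lineLeft k) (lineLeft l) := by
  rw [lineLeft, lineLeft, Finset.disjoint_filter]
  rintro z - ⟨hu, h1⟩ ⟨-, h2⟩
  exact h _ hu (h1.symm.trans h2)

lemma disjoint_lineRight {k l : ZMod N} (h : ∀ u, IsUnit u → k * u ≠ l * u) :
    Disjoint (lineRight k) (lineRight l) := by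
  rw [lineRight, lineRight, Finset.disjoint_filter]
  rintro z - ⟨hu, h1⟩ ⟨-, h2⟩
  exact h _ hu (h1.symm.trans h2)

lemma disjoint_lineLeft_lineRight {k l : ZMod N} (h : ∀ u, IsUnit u → k * (l * u) ≠ u) :
    Disjoint (lineLeft k) (lineRight l) := by
  rw [lineLeft, lineRight, Finset.disjoint_filter]
  rintro z - ⟨-, h1⟩ ⟨hu, h2⟩
  exact h _ hu (by rw [← h2, ← h1])

end Lines
end KPT

namespace KPT

section CoprimePairs

/-- The number of coprime pairs in a ring. -/
noncomputable def coprimeCount (R : Type) [CommRing R] : ℕ :=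
  Nat.card {z : R × R // IsCoprime z.1 z.2}

lemma isCoprime_ringEquiv_iff {R S : Type} [CommRing R] [CommRing S] (e : R ≃+* S) (a b : R) :
    IsCoprime (e a) (e b) ↔ IsCoprime a b :=
  ⟨fun h => by simpa using h.map e.symm.toRingHom, fun h => h.map e.toRingHom⟩

lemma coprimeCount_congr {R S : Type} [CommRing R] [CommRing S] (e : R ≃+* S) :
    coprimeCount R = coprimeCount S :=
  Nat.card_congr ((Equiv.prodCongr e.toEquiv e.toEquiv).subtypeEquiv
    fun z => (isCoprime_ringEquiv_iff e z.1 z.2).symm)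

lemma isCoprime_prod_iff {R S : Type} [CommRing R] [CommRing S] {a b : R × S} :
    IsCoprime a b ↔ IsCoprime a.1 b.1 ∧ IsCoprime a.2 b.2 := by
  constructor
  · exact fun h => ⟨h.map (RingHom.fst R S), h.map (RingHom.snd R S)⟩
  · rintro ⟨⟨u, v, h⟩, ⟨u', v', h'⟩⟩
    exact ⟨(u, u'), (v, v'), Prod.ext h h'⟩

lemma coprimeCount_prod (R S : Type) [CommRing R] [CommRing S] :
    coprimeCount (R × S) = coprimeCount R * coprimeCount S := by
  rw [coprimeCount, coprimeCount, coprimeCount, ← Nat.card_prod]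
  refine Nat.card_congr (((Equiv.prodProdProdComm R S R S).subtypeEquiv
    (q := fun w => IsCoprime w.1.1 w.1.2 ∧ IsCoprime w.2.1 w.2.2) fun z => ?_).trans
    (Equiv.subtypeProdEquivProd (p := fun w : R × R => IsCoprime w.1 w.2)
      (q := fun w : S × S => IsCoprime w.1 w.2)))
  exact isCoprime_prod_iff

lemma isCoprime_primePow_iff {p k : ℕ} (hp : p.Prime) (hk : 0 < k) (a b : ZMod (p ^ k)) :
    IsCoprime a b ↔ IsUnit a ∨ IsUnit b := by
  have : Fact p.Prime := ⟨hp⟩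
  constructor
  · intro h
    by_contra! hab
    have hz (x : ZMod (p ^ k)) (hx : ¬ IsUnit x) :
        ZMod.castHom (dvd_pow_self p hk.ne') (ZMod p) x = 0 := by
      rw [← ZMod.natCast_zmod_val x] at hx ⊢
      rw [ZMod.isUnit_iff_coprime, Nat.coprime_pow_right_iff hk, Nat.coprime_comm,
        hp.coprime_iff_not_dvd, not_not] at hx
      rw [map_natCast, ZMod.natCast_eq_zero_iff]
      exact hx
    have := h.map (ZMod.castHom (dvd_pow_self p hk.ne') (ZMod p))
    rw [hz a hab.1, hz b hab.2] at this
    exact not_isCoprime_zero_zero this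
  · rintro (h | h)
    · exact isCoprime_comm.1 (h.elim fun u hu => ⟨0, ↑u⁻¹, by simp [← hu]⟩)
    · exact h.elim fun u hu => ⟨0, ↑u⁻¹, by simp [← hu]⟩

lemma coprimeCount_primePow {p k : ℕ} (hp : p.Prime) (hk : 0 < k) :
    (coprimeCount (ZMod (p ^ k)) : ℚ) =
      (p ^ k : ℕ) * (p ^ k).totient * (1 + 1 / (p : ℚ)) := by
  classical
  have : Fact p.Prime := ⟨hp⟩
  have h1 : coprimeCount (ZMod (p ^ k)) +
      (p ^ k - (p ^ k).totient) * (p ^ k - (p ^ k).totient) = p ^ k * p ^ k := by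
    have hc : (Finset.univ.filter fun a : ZMod (p ^ k) => ¬ IsUnit a).card =
        p ^ k - (p ^ k).totient := by
      have := Finset.card_filter_add_card_filter_not (s := (Finset.univ : Finset (ZMod (p ^ k))))
        (fun a => IsUnit a)
      rw [card_filter_isUnit, Finset.card_univ, ZMod.card] at this
      omega
    rw [coprimeCount, Nat.card_eq_fintype_card, Fintype.card_subtype, ← hc,
      ← Finset.card_product, ← Finset.filter_product]
    convert Finset.card_filter_add_card_filter_not (s := (Finset.univ : Finset (ZMod (p ^ k) × ZMod (p ^ k))))
        (fun z => IsCoprime z.1 z.2) using 3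
    · ext z
      simp [isCoprime_primePow_iff hp hk]
    · simp
  have h2 : (p ^ k).totient ≤ p ^ k := Nat.totient_le _
  have h3 := congrArg (Nat.cast : ℕ → ℚ) h1
  push_cast [Nat.cast_sub h2] at h3
  obtain ⟨j, rfl⟩ := Nat.exists_eq_succ_of_ne_zero hk.ne'
  have h4 : ((p ^ (j + 1)).totient : ℚ) = p ^ j * (p - 1) := by
    rw [Nat.totient_prime_pow_succ hp]
    push_cast [Nat.cast_sub hp.one_le]
    ring
  have hp0 : (p : ℚ) ≠ 0 := by exact_mod_cast hp.ne_zero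
  simp only [Nat.succ_eq_add_one] at *
  rw [h4] at h3 ⊢
  have h5 : (p : ℚ) ^ (j + 1) * (1 + 1 / p) = p ^ j * (p + 1) := by
    field_simp
    ring
  push_cast
  linear_combination h3 - (p : ℚ) ^ j * (p - 1) * h5

lemma coprimeCount_zmod {N : ℕ} (hN : N ≠ 0) :
    (coprimeCount (ZMod N) : ℚ) = N * N.totient * ∏ p ∈ N.primeFactors, (1 + 1 / (p : ℚ)) := by
  induction N using Nat.recOnPosPrimePosCoprime with
  | prime_pow p k hp hk =>
    rw [coprimeCount_primePow hp hk, Nat.primeFactors_prime_pow hk.ne' hp, Finset.prod_singleton]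
  | zero => exact absurd rfl hN
  | one =>
    have : coprimeCount (ZMod 1) = 1 := by
      have h (z : ZMod 1 × ZMod 1) : IsCoprime z.1 z.2 := ⟨0, 0, Subsingleton.elim _ _⟩
      simp [coprimeCount, h]
    simp [this]
  | coprime a b ha hb hab iha ihb =>
    rw [coprimeCount_congr (ZMod.chineseRemainder hab), coprimeCount_prod, Nat.cast_mul,
      iha (by omega), ihb (by omega), hab.primeFactors_mul, Nat.totient_mul hab,
      Finset.prod_union hab.disjoint_primeFactors]
    push_cast
    ring

end CoprimePairs
end KPT

namespace KPT

section Counts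

open Classical Finset

variable {N : ℕ}

lemma isCoprime_of_isUnit_left {a b : ZMod N} (h : IsUnit a) : IsCoprime a b :=
  h.elim fun u hu => ⟨↑u⁻¹, 0, by simp [← hu]⟩

variable [NeZero N]

lemma card_filter_isCoprime :
    #{z : ZMod N × ZMod N | IsCoprime z.1 z.2} = coprimeCount (ZMod N) := by
  rw [coprimeCount, Nat.card_eq_fintype_card, Fintype.card_subtype]

lemma isCoprime_of_mem_lineLeft {k : ZMod N} {z : ZMod N × ZMod N} (h : z ∈ lineLeft k) :
    IsCoprime z.1 z.2 := by
  rw [lineLeft, mem_filter] at h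
  exact isCoprime_of_isUnit_left h.2.1

lemma isCoprime_of_mem_lineRight {k : ZMod N} {z : ZMod N × ZMod N} (h : z ∈ lineRight k) :
    IsCoprime z.1 z.2 := by
  rw [lineRight, mem_filter] at h
  exact (isCoprime_of_isUnit_left h.2.1).symm

lemma isUnit_mul_ne_zero {N : ℕ} (hN : 5 ≤ N) {u : ZMod N} (hu : IsUnit u) :
    u ≠ 0 ∧ 2 * u ≠ 0 ∧ 3 * u ≠ 0 ∧ 4 * u ≠ 0 := by
  have h1 := natCast_mul_ne_zero hu (k := 1) (by norm_num) (by omega)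
  have h2 := natCast_mul_ne_zero hu (k := 2) (by norm_num) (by omega)
  have h3 := natCast_mul_ne_zero hu (k := 3) (by norm_num) (by omega)
  have h4 := natCast_mul_ne_zero hu (k := 4) (by norm_num) (by omega)
  simp only [Nat.cast_one, one_mul, Nat.cast_ofNat] at *
  exact ⟨h1, h2, h3, h4⟩

lemma card_isFree (hN : 5 ≤ N) :
    #{z : ZMod N × ZMod N | IsFree z} + 6 * N.totient = coprimeCount (ZMod N) := by
  have key : ({z | IsCoprime z.1 z.2} : Finset (ZMod N × ZMod N)) =
      ({z | IsFree z} : Finset (ZMod N × ZMod N)) ∪ (lineRight 0 ∪ (lineLeft 0 ∪ (lineLeft (-1) ∪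
        (lineLeft 1 ∪ (lineLeft (-2) ∪ lineRight (-2)))))) := by
    ext z
    simp only [mem_union, mem_filter, mem_univ, true_and]
    constructor
    · intro h
      by_cases hz : IsFree z
      · exact Or.inl hz
      · right
        obtain ⟨u, hu, h⟩ := exists_of_not_isFree h hz
        simp only [lineLeft, lineRight, mem_filter, mem_univ, true_and]
        rcases h with rfl | rfl | rfl | rfl | rfl | rfl <;> simp [hu]
    · rintro (h | h | h | h | h | h | h)
      · exact h.1
      · exact isCoprime_of_mem_lineRight h
      · exact isCoprime_of_mem_lineLeft h
      · exact isCoprime_of_mem_lineLeft h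
      · exact isCoprime_of_mem_lineLeft h
      · exact isCoprime_of_mem_lineLeft h
      · exact isCoprime_of_mem_lineRight h
  have hd (k : ZMod N) (hk : k = 0 ∨ k = -1 ∨ k = 1 ∨ k = -2) :
      Disjoint ({z | IsFree z} : Finset (ZMod N × ZMod N)) (lineLeft k) := by
    rw [lineLeft, disjoint_filter]
    rintro z - ⟨-, hz⟩ ⟨-, hk'⟩
    grind
  have hd' (k : ZMod N) (hk : k = 0 ∨ k = -2) :
      Disjoint ({z | IsFree z} : Finset (ZMod N × ZMod N)) (lineRight k) := by
    rw [lineRight, disjoint_filter]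
    rintro z - ⟨-, hz⟩ ⟨-, hk'⟩
    grind
  rw [← card_filter_isCoprime, key]
  clear key
  have hu (u : ZMod N) (hu : IsUnit u) := isUnit_mul_ne_zero hN hu
  repeat rw [card_union_of_disjoint]
  · simp only [card_lineLeft, card_lineRight]
    ring
  any_goals simp only [disjoint_union_right]
  · refine disjoint_lineLeft_lineRight ?_
    grind
  · refine ⟨disjoint_lineLeft ?_, disjoint_lineLeft_lineRight ?_⟩ <;> grind
  · refine ⟨disjoint_lineLeft ?_, disjoint_lineLeft ?_, disjoint_lineLeft_lineRight ?_⟩ <;> grind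
  · refine ⟨disjoint_lineLeft ?_, disjoint_lineLeft ?_, disjoint_lineLeft ?_,
      disjoint_lineLeft_lineRight ?_⟩ <;> grind
  · refine ⟨(disjoint_lineLeft_lineRight ?_).symm, (disjoint_lineLeft_lineRight ?_).symm,
      (disjoint_lineLeft_lineRight ?_).symm, (disjoint_lineLeft_lineRight ?_).symm,
      disjoint_lineRight ?_⟩ <;> grind
  · exact ⟨hd' _ (by simp), hd _ (by simp), hd _ (by simp), hd _ (by simp), hd _ (by simp),
      hd' _ (by simp)⟩

lemma card_vertexType (hN : 5 ≤ N) :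
    12 * Fintype.card (VertexType N) + 6 * N.totient = coprimeCount (ZMod N) := by
  rw [← card_isFree hN, card_filter_eq_mul_card_classes (vertexSetoid N) IsFree
    (fun z y h hz => VertexRel.isFree h hz) 12 (fun z hz => card_vertexRel (by omega) hz)]

lemma card_isDiag (hN : 5 ≤ N) : #{z : ZMod N × ZMod N | IsDiag z} = 2 * N.totient := by
  have key : ({z | IsDiag z} : Finset (ZMod N × ZMod N)) = lineLeft 1 ∪ lineLeft (-1) := by
    ext z
    simp only [mem_union, mem_filter, mem_univ, true_and, lineLeft, ← and_or_left]
    constructor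
    · rintro ⟨⟨p, q, hpq⟩, h⟩
      refine ⟨?_, by grind⟩
      rcases h with h | h
      · exact IsUnit.of_mul_eq_one (p + q) (by linear_combination hpq + q * h)
      · exact IsUnit.of_mul_eq_one (p - q) (by linear_combination hpq - q * h)
    · exact fun h => ⟨isCoprime_of_isUnit_left h.1, by grind⟩
  have hd (u : ZMod N) (hu : IsUnit u) : 1 * u ≠ -1 * u := by
    have := isUnit_mul_ne_zero hN hu
    grind
  rw [key, card_union_of_disjoint (disjoint_lineLeft hd), card_lineLeft, card_lineLeft]
  ring

/-- Generating pairs with an entry of order at most two. -/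
def IsInvolutive (z : ZMod N × ZMod N) : Prop :=
  IsCoprime z.1 z.2 ∧ (2 * z.1 = 0 ∨ 2 * z.2 = 0)

/-- Generating pairs with one entry twice the other up to sign. -/
def IsDoubling (z : ZMod N × ZMod N) : Prop :=
  IsCoprime z.1 z.2 ∧ (z.2 = 2 * z.1 ∨ z.2 = -2 * z.1 ∨ z.1 = 2 * z.2 ∨ z.1 = -2 * z.2)

lemma isHalf_iff {N : ℕ} {z : ZMod N × ZMod N} : IsHalf z ↔ IsInvolutive z ∨ IsDoubling z :=
  and_or_left

lemma card_edgeType (hN : 5 ≤ N) :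
    8 * Fintype.card (EdgeType N) + 2 * N.totient + #{z : ZMod N × ZMod N | IsHalf z} =
      coprimeCount (ZMod N) := by
  have h := card_filter_eq_mul_card_classes (edgeSetoid N) IsFull
    (fun z y h hz => EdgeRel.isFull h hz) 8 (fun z hz => card_edgeRel
      (fun h => hz.2.2 ⟨hz.1, Or.inl h⟩) (fun h => hz.2.2 ⟨hz.1, Or.inr h⟩)
      (two_mul_ne_zero_of_isCoprime (by omega) hz.1) hz.not_dartRel_bar)
  rw [← h, ← card_isDiag hN, ← card_filter_isCoprime, ← card_union_of_disjoint,
    ← card_union_of_disjoint]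
  · congr 1
    ext z
    simp only [mem_union, mem_filter, mem_univ, true_and]
    change ((IsCoprime z.1 z.2 ∧ ¬ IsHalf z ∧ ¬ IsDiag z) ∨ _) ∨ _ ↔ _
    have : IsHalf z → IsCoprime z.1 z.2 := And.left
    have : IsDiag z → IsCoprime z.1 z.2 := And.left
    tauto
  · rw [← filter_or, disjoint_filter]
    rintro z - (h | h)
    · exact h.2.1
    · exact h.not_isHalf (by omega)
  · rw [disjoint_filter]
    exact fun z _ h => h.2.2

end Counts
end KPT

namespace KPT

section HalfEdgeCounts

open Classical Finset

variable {N : ℕ}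

lemma EdgeRel.isInvolutive {z y : ZMod N × ZMod N} (h : EdgeRel z y) (hz : IsInvolutive z) :
    IsInvolutive y := by
  refine ⟨h.isCoprime hz.1, ?_⟩
  have := hz.2
  clear hz
  rcases h with h | h
  · rcases h with h | h | h | h <;> grind
  · rcases h with h | h | h | h <;> grind [bar]

lemma EdgeRel.isDoubling {z y : ZMod N × ZMod N} (h : EdgeRel z y) (hz : IsDoubling z) :
    IsDoubling y := by
  refine ⟨h.isCoprime hz.1, ?_⟩
  have := hz.2
  clear hz
  rcases h with h | h
  · rcases h with h | h | h | h <;> grind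
  · rcases h with h | h | h | h <;> grind [bar]

lemma isUnit_of_isCoprime_mul {k u : ZMod N} (h : IsCoprime u (k * u)) : IsUnit u := by
  obtain ⟨p, q, h⟩ := h
  exact IsUnit.of_mul_eq_one (p + q * k) (by linear_combination h)

lemma IsDoubling.not_isInvolutive (hN : 5 ≤ N) {z : ZMod N × ZMod N} (h : IsDoubling z) :
    ¬ IsInvolutive z := by
  rintro ⟨-, h'⟩
  obtain ⟨hc, h⟩ := h
  obtain ⟨a, b⟩ := z
  simp only at *
  rcases h with rfl | rfl | rfl | rfl
  · have := isUnit_mul_ne_zero hN (isUnit_of_isCoprime_mul hc)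
    clear hc
    grind
  · have := isUnit_mul_ne_zero hN (isUnit_of_isCoprime_mul hc)
    clear hc
    grind
  · have := isUnit_mul_ne_zero hN (isUnit_of_isCoprime_mul hc.symm)
    clear hc
    grind
  · have := isUnit_mul_ne_zero hN (isUnit_of_isCoprime_mul hc.symm)
    clear hc
    grind

lemma IsDoubling.not_dartRel_bar (hN : 5 ≤ N) {z : ZMod N × ZMod N} (h : IsDoubling z) :
    ¬ DartRel (bar z) z := by
  obtain ⟨hc, h⟩ := h
  obtain ⟨a, b⟩ := z
  simp only [DartRel, bar] at *
  rcases h with rfl | rfl | rfl | rfl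
  · have := isUnit_mul_ne_zero hN (isUnit_of_isCoprime_mul hc)
    clear hc
    grind
  · have := isUnit_mul_ne_zero hN (isUnit_of_isCoprime_mul hc)
    clear hc
    grind
  · have := isUnit_mul_ne_zero hN (isUnit_of_isCoprime_mul hc.symm)
    clear hc
    grind
  · have := isUnit_mul_ne_zero hN (isUnit_of_isCoprime_mul hc.symm)
    clear hc
    grind

lemma IsInvolutive.edgeRel_iff {z y : ZMod N × ZMod N} (h : IsInvolutive z) :
    EdgeRel z y ↔ DartRel z y := by
  refine ⟨fun hy => hy.elim id fun hy => ?_, Or.inl⟩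
  have h := h.2
  simp only [DartRel, bar] at *
  grind

lemma IsHalf.ne (hN : 4 ≤ N) {z : ZMod N × ZMod N} (h : IsHalf z) : z.1 ≠ z.2 :=
  fun hd => IsDiag.not_isHalf hN ⟨h.1, Or.inl hd⟩ h

lemma IsHalf.ne_neg (hN : 4 ≤ N) {z : ZMod N × ZMod N} (h : IsHalf z) : z.1 ≠ -z.2 :=
  fun hd => IsDiag.not_isHalf hN ⟨h.1, Or.inr hd⟩ h

variable [NeZero N]

lemma card_isDoubling_classes (hN : 5 ≤ N) :
    8 * Fintype.card {c : Quotient (edgeSetoid N) // IsDoubling c.out} =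
      #{z : ZMod N × ZMod N | IsDoubling z} := by
  refine (card_filter_eq_mul_card_classes (edgeSetoid N) IsDoubling
    (fun z y h hz => EdgeRel.isDoubling h hz) 8 fun z hz => ?_).symm
  have h := isHalf_iff.2 (Or.inr hz)
  exact card_edgeRel (h.ne (by omega)) (h.ne_neg (by omega))
    (two_mul_ne_zero_of_isCoprime (by omega) hz.1) (hz.not_dartRel_bar hN)

lemma card_isInvolutive_classes (hN : 5 ≤ N) :
    4 * Fintype.card {c : Quotient (edgeSetoid N) // IsInvolutive c.out} =
      #{z : ZMod N × ZMod N | IsInvolutive z} := by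
  refine (card_filter_eq_mul_card_classes (edgeSetoid N) IsInvolutive
    (fun z y h hz => EdgeRel.isInvolutive h hz) 4 fun z hz => ?_).symm
  have h := isHalf_iff.2 (Or.inl hz)
  rw [← card_dartRel (h.ne (by omega)) (h.ne_neg (by omega))
    (two_mul_ne_zero_of_isCoprime (by omega) hz.1)]
  congr 1
  ext y
  rw [mem_filter, mem_filter]
  exact and_congr_right fun _ => hz.edgeRel_iff

lemma card_halfEdgeType (hN : 5 ≤ N) :
    8 * Fintype.card (HalfEdgeType N) = 2 * #{z : ZMod N × ZMod N | IsInvolutive z} +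
      #{z : ZMod N × ZMod N | IsDoubling z} := by
  have h : Fintype.card (HalfEdgeType N) =
      Fintype.card {c : Quotient (edgeSetoid N) // IsInvolutive c.out} +
        Fintype.card {c : Quotient (edgeSetoid N) // IsDoubling c.out} := by
    rw [← Fintype.card_subtype_or_disjoint]
    · exact Fintype.card_congr (Equiv.subtypeEquivRight fun c => isHalf_iff)
    · rw [Pi.disjoint_iff]
      intro c
      rw [Prop.disjoint_iff]
      exact fun h => h.2.not_isInvolutive hN h.1
  rw [h, ← card_isInvolutive_classes hN, ← card_isDoubling_classes hN]
  ring

lemma card_isHalf (hN : 5 ≤ N) :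
    #{z : ZMod N × ZMod N | IsHalf z} = #{z : ZMod N × ZMod N | IsInvolutive z} +
      #{z : ZMod N × ZMod N | IsDoubling z} := by
  rw [← card_union_of_disjoint]
  · congr 1
    ext z
    rw [mem_union, mem_filter, mem_filter, mem_filter, isHalf_iff]
    tauto
  · rw [disjoint_filter]
    exact fun z _ h h' => h'.not_isInvolutive hN h

lemma filter_isDoubling : ({z | IsDoubling z} : Finset (ZMod N × ZMod N)) =
    lineLeft 2 ∪ (lineLeft (-2) ∪ (lineRight 2 ∪ lineRight (-2))) := by
  ext ⟨a, b⟩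
  simp only [mem_union, mem_filter, mem_univ, true_and, lineLeft, lineRight]
  constructor
  · rintro ⟨hc, h⟩
    simp only at *
    rcases h with rfl | rfl | rfl | rfl
    · simp [isUnit_of_isCoprime_mul hc]
    · simp [isUnit_of_isCoprime_mul hc]
    · simp [isUnit_of_isCoprime_mul hc.symm]
    · simp [isUnit_of_isCoprime_mul hc.symm]
  · rintro (⟨hu, h⟩ | ⟨hu, h⟩ | ⟨hu, h⟩ | ⟨hu, h⟩)
    · exact ⟨isCoprime_of_isUnit_left hu, by tauto⟩
    · exact ⟨isCoprime_of_isUnit_left hu, by tauto⟩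
    · exact ⟨(isCoprime_of_isUnit_left hu).symm, by tauto⟩
    · exact ⟨(isCoprime_of_isUnit_left hu).symm, by tauto⟩

lemma card_isDoubling (hN : 6 ≤ N) :
    #{z : ZMod N × ZMod N | IsDoubling z} = 4 * N.totient := by
  have hu (u : ZMod N) (hu : IsUnit u) := isUnit_ne hN hu
  rw [filter_isDoubling]
  repeat rw [card_union_of_disjoint]
  · simp only [card_lineLeft, card_lineRight]
    ring
  any_goals simp only [disjoint_union_right]
  · refine disjoint_lineRight ?_
    grind
  · refine ⟨disjoint_lineLeft_lineRight ?_, disjoint_lineLeft_lineRight ?_⟩ <;> grind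
  · refine ⟨disjoint_lineLeft ?_, disjoint_lineLeft_lineRight ?_,
      disjoint_lineLeft_lineRight ?_⟩ <;> grind

lemma card_isInvolutive (hN : 5 ≤ N) : #{z : ZMod N × ZMod N | IsInvolutive z} =
    2 * #{z : ZMod N × ZMod N | IsCoprime z.1 z.2 ∧ 2 * z.1 = 0} := by
  have hs : #{z : ZMod N × ZMod N | IsCoprime z.1 z.2 ∧ 2 * z.2 = 0} =
      #{z : ZMod N × ZMod N | IsCoprime z.1 z.2 ∧ 2 * z.1 = 0} := by
    rw [← card_image_of_injective _ Prod.swap_injective]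
    congr 1
    ext ⟨a, b⟩
    simp [isCoprime_comm]
  rw [two_mul]
  nth_rewrite 2 [← hs]
  rw [← card_union_of_disjoint]
  · congr 1
    ext z
    rw [mem_union, mem_filter, mem_filter, mem_filter, IsInvolutive]
    tauto
  · rw [disjoint_filter]
    exact fun z _ h h' => two_mul_ne_zero_of_isCoprime (by omega) h.1 ⟨h.2, h'.2⟩

lemma card_isCoprime_zero :
    #{z : ZMod N × ZMod N | IsCoprime z.1 z.2 ∧ z.1 = 0} = N.totient := by
  rw [← card_lineRight (0 : ZMod N)]
  congr 1
  ext ⟨a, b⟩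
  rw [lineRight, mem_filter, mem_filter]
  simp only [mem_univ, true_and, zero_mul]
  refine and_congr_left ?_
  rintro rfl
  exact isCoprime_zero_left

lemma card_isInvolutive_of_odd (hN : 5 ≤ N) (h : Odd N) :
    #{z : ZMod N × ZMod N | IsInvolutive z} = 2 * N.totient := by
  rw [card_isInvolutive hN, ← card_isCoprime_zero]
  congr 2
  ext z
  rw [mem_filter, mem_filter]
  have h2 : IsUnit (2 : ZMod N) := by
    have := (ZMod.isUnit_iff_coprime 2 N).2 (Nat.coprime_two_left.2 h)
    exact_mod_cast this
  rw [h2.mul_right_eq_zero]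

lemma isCoprime_natCast_iff {m : ℕ} (hm : m ∣ N) (b : ZMod N) :
    IsCoprime (m : ZMod N) b ↔ m.Coprime b.val := by
  constructor
  · intro h
    have h := h.map (ZMod.castHom hm (ZMod m))
    rw [map_natCast, ZMod.natCast_self, isCoprime_zero_left, ← ZMod.natCast_zmod_val b,
      map_natCast, ZMod.isUnit_iff_coprime] at h
    exact h.symm
  · intro h
    have := (Nat.isCoprime_iff_coprime.2 h).map (Int.castRingHom (ZMod N))
    simpa using this

lemma card_isCoprime_half {m : ℕ} (hm : N = 2 * m) :
    #{z : ZMod N × ZMod N | IsCoprime z.1 z.2 ∧ z.1 = m} = 2 * m.totient := by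
  have h1 : #{x ∈ range N | m.Coprime x} = 2 * m.totient := by
    have h0 := Nat.filter_coprime_Ico_eq_totient m 0
    have h1 := Nat.filter_coprime_Ico_eq_totient m m
    rw [two_mul, hm, range_eq_Ico, ← Ico_union_Ico_eq_Ico (Nat.zero_le m) (by omega : m ≤ 2 * m),
      filter_union, card_union_of_disjoint]
    · rw [zero_add] at h0
      rw [h0, two_mul, h1]
    · exact disjoint_filter_filter (Ico_disjoint_Ico_consecutive _ _ _)
  rw [← h1]
  refine card_bij (fun z _ => z.2.val) ?_ ?_ ?_
  · rintro ⟨a, b⟩ h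
    rw [mem_filter] at h
    obtain ⟨-, h, rfl⟩ := h
    rw [mem_filter, mem_range]
    exact ⟨ZMod.val_lt b, (isCoprime_natCast_iff ⟨2, by omega⟩ b).1 h⟩
  · rintro ⟨a, b⟩ h ⟨a', b'⟩ h' hb
    rw [mem_filter] at h h'
    obtain ⟨-, -, rfl⟩ := h
    obtain ⟨-, -, rfl⟩ := h'
    exact Prod.ext rfl (ZMod.val_injective N hb)
  · intro x hx
    rw [mem_filter, mem_range] at hx
    refine ⟨(m, x), ?_, ZMod.val_cast_of_lt hx.1⟩
    rw [mem_filter]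
    refine ⟨mem_univ _, (isCoprime_natCast_iff ⟨2, by omega⟩ _).2 ?_, rfl⟩
    rw [ZMod.val_cast_of_lt hx.1]
    exact hx.2

lemma two_mul_eq_zero_iff {m : ℕ} (hm : N = 2 * m) (a : ZMod N) :
    2 * a = 0 ↔ a = 0 ∨ a = m := by
  constructor
  · intro h
    rw [← ZMod.natCast_zmod_val a] at h ⊢
    have h2 : ((2 * a.val : ℕ) : ZMod N) = 0 := by exact_mod_cast h
    obtain ⟨c, hc⟩ := (ZMod.natCast_eq_zero_iff _ _).1 h2
    have hlt := ZMod.val_lt a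
    have : a.val = m * c := by
      have hc' : 2 * a.val = 2 * (m * c) := hc.trans (by rw [← mul_assoc, ← hm])
      omega
    have hc2 : c < 2 := by
      by_contra! hc2
      nlinarith
    interval_cases c
    · exact Or.inl (by simp_all)
    · exact Or.inr (by rw [this, mul_one])
  · rintro (rfl | rfl)
    · exact mul_zero 2
    · exact_mod_cast (congrArg (Nat.cast : ℕ → ZMod N) hm).symm.trans (ZMod.natCast_self N)

lemma card_isInvolutive_of_even (hN : 5 ≤ N) (h : Even N) :
    #{z : ZMod N × ZMod N | IsInvolutive z} = 2 * N.totient + 4 * (N / 2).totient := by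
  obtain ⟨m, hm⟩ := h.two_dvd
  have hm' : N / 2 = m := by omega
  have hm0 : (m : ZMod N) ≠ 0 := by
    rw [Ne, ZMod.natCast_eq_zero_iff]
    exact fun h => absurd (Nat.le_of_dvd (by omega) h) (by omega)
  have : #{z : ZMod N × ZMod N | IsCoprime z.1 z.2 ∧ 2 * z.1 = 0} =
      N.totient + 2 * m.totient := by
    rw [← card_isCoprime_zero (N := N), ← card_isCoprime_half hm, ← card_union_of_disjoint]
    · congr 1
      ext z
      rw [mem_union, mem_filter, mem_filter, mem_filter, two_mul_eq_zero_iff hm]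
      tauto
    · rw [disjoint_filter]
      exact fun z _ h h' => hm0 (h'.2.symm.trans h.2)
  rw [card_isInvolutive hN, this, hm']
  ring

end HalfEdgeCounts
end KPT

namespace KPT

section Structure

open Finset Module TensorProduct

variable {N : ℕ}

lemma nonempty_vertexType (hN : 6 ≤ N) : Nonempty (VertexType N) :=
  ⟨vertex (1, 2 * 1) (isFree_two_mul hN isUnit_one)⟩

lemma exists_halfEdgeVertex (hN : 6 ≤ N) :
    ∃ (c : HalfEdgeType N) (v : VertexType N), halfEdgeVertex c = some v := by
  have hfree : IsFree ((1, 2 * 1) : ZMod N × ZMod N) := isFree_two_mul hN isUnit_one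
  have hhalf : IsHalf ((1, 2 * 1) : ZMod N × ZMod N) := ⟨hfree.1, Or.inr (Or.inl rfl)⟩
  refine ⟨halfEdge _ hhalf, ?_⟩
  rw [halfEdgeVertex]
  split_ifs with h h'
  · exact ⟨_, rfl⟩
  · exact ⟨_, rfl⟩
  · exact ((edgeRel_out (1, 2 * 1)).symm.elim (fun hd => h (hd.isFree hfree))
      fun hd => h' ((dartRel_bar_right.2 hd).isFree hfree)).elim

variable [NeZero N]

lemma coprimeCount_five : coprimeCount (ZMod 5) = 24 := by
  have h := coprimeCount_zmod (N := 5) (by norm_num)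
  have hp : Nat.Prime 5 := by norm_num
  rw [hp.primeFactors, prod_singleton, Nat.totient_prime hp] at h
  norm_num at h
  exact_mod_cast h

lemma isEmpty_vertexType_five : IsEmpty (VertexType 5) := by
  have h := card_vertexType (N := 5) le_rfl
  rw [coprimeCount_five, Nat.totient_prime (by norm_num)] at h
  exact Fintype.card_eq_zero_iff.1 (by omega)

lemma isEmpty_edgeType_five : IsEmpty (EdgeType 5) :=
  ⟨fun e => isEmpty_vertexType_five.false (edgeSource e)⟩

open Classical in
lemma finrank_eq (hN : 5 ≤ N) : (finrank ℚ (ℚ ⊗[ℤ] MnMinus 2 (ZMod N)) : ℚ) =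
    1 + coprimeCount (ZMod N) / 24 - (N.totient : ℚ) / 4 -
      (#{z : ZMod N × ZMod N | IsInvolutive z} : ℚ) / 8 := by
  rw [finrank_rat_tensor]
  obtain rfl | hN6 : N = 5 ∨ 6 ≤ N := by omega
  · have := isEmpty_vertexType_five
    have := isEmpty_edgeType_five
    rw [finrank_of_isEmpty (ker_presentation (by omega)) (presentation_surjective (by omega)),
      coprimeCount_five, card_isInvolutive_of_odd hN (by decide),
      Nat.totient_prime (by norm_num)]
    norm_num
  · have := nonempty_vertexType hN6
    have h1 := finrank_of_connected (exists_halfEdgeVertex hN6) (isConnectedGraph hN6)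
      (ker_presentation (by omega)) (presentation_surjective (by omega))
    have h2 := card_edgeType hN
    rw [card_isHalf hN, card_isDoubling hN6] at h2
    have h3 := card_vertexType hN
    have h1 := congrArg (Nat.cast : ℕ → ℚ) h1
    have h2 := congrArg (Nat.cast : ℕ → ℚ) h2
    have h3 := congrArg (Nat.cast : ℕ → ℚ) h3
    push_cast at h1 h2 h3
    linear_combination h1 + h2 / 8 - h3 / 12

open Classical in
lemma nonempty_torsion_equiv (hN : 5 ≤ N) {n : ℕ}
    (hn : 2 * #{z : ZMod N × ZMod N | IsInvolutive z} + 4 * N.totient = 8 * (n + 1)) :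
    Nonempty (AddCommGroup.torsion (MnMinus 2 (ZMod N)) ≃+ (Fin n → ZMod 2)) := by
  have hH := card_halfEdgeType hN
  obtain rfl | hN6 : N = 5 ∨ 6 ≤ N := by omega
  · have := isEmpty_vertexType_five
    have := isEmpty_edgeType_five
    have h := torsion_of_isEmpty (ker_presentation (N := 5) (by omega))
      (presentation_surjective (by omega))
    have h2 := card_edgeType (N := 5) le_rfl
    rw [card_isHalf le_rfl, Fintype.card_eq_zero, coprimeCount_five] at h2
    rw [card_isInvolutive_of_odd hN (by decide)] at hn hH h2
    rw [Nat.totient_prime (by norm_num)] at hn hH h2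
    rwa [show Fintype.card (HalfEdgeType 5) = n by omega] at h
  · have := nonempty_vertexType hN6
    have h := torsion_of_connected (exists_halfEdgeVertex hN6) (isConnectedGraph hN6)
      (ker_presentation (by omega)) (presentation_surjective (by omega))
    rw [card_isDoubling hN6] at hH
    rwa [show Fintype.card (HalfEdgeType N) - 1 = n by omega] at h

end Structure
end KPT

open KPT TensorProduct in
theorem statement_17 (N : ℕ) (hN : 5 ≤ N) :
    (Even N →
      (Module.finrank ℚ (ℚ ⊗[ℤ] MnMinus 2 (ZMod N)) : ℚ)
          = 1 - ((N.totient : ℚ) + ((N/2).totient : ℚ))/2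
            + ((N : ℚ) * (N.totient : ℚ))/24 * ∏ p ∈ N.primeFactors, (1 + 1/(p:ℚ)) ∧
      Nonempty (AddCommGroup.torsion (MnMinus 2 (ZMod N))
          ≃+ (Fin (N.totient + (N/2).totient - 1) → ZMod 2))) ∧
    (Odd N →
      (Module.finrank ℚ (ℚ ⊗[ℤ] MnMinus 2 (ZMod N)) : ℚ)
          = 1 - (N.totient : ℚ)/2
            + ((N : ℚ) * (N.totient : ℚ))/24 * ∏ p ∈ N.primeFactors, (1 + 1/(p:ℚ)) ∧
      Nonempty (AddCommGroup.torsion (MnMinus 2 (ZMod N))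
          ≃+ (Fin (N.totient - 1) → ZMod 2))) := by
  have : NeZero N := ⟨by omega⟩
  have hpos : 0 < N.totient := Nat.totient_pos.2 (by omega)
  refine ⟨fun h => ⟨?_, nonempty_torsion_equiv hN ?_⟩,
    fun h => ⟨?_, nonempty_torsion_equiv hN ?_⟩⟩
  · rw [finrank_eq hN, coprimeCount_zmod (by omega), card_isInvolutive_of_even hN h]
    push_cast
    ring
  · have : 0 < (N / 2).totient := Nat.totient_pos.2 (by omega)
    rw [card_isInvolutive_of_even hN h]
    omega
  · rw [finrank_eq hN, coprimeCount_zmod (by omega), card_isInvolutive_of_odd hN h]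
    push_cast
    ring
  · rw [card_isInvolutive_of_odd hN h]
    omega
end
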